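/- In the resolvent-sequence setting, define for 0 < α₁ < α₂ < β the quantity Jₙ(α₁, α₂) := ∫₀^{α₁} ( ρ₁ λₙ² |v¹ₙ|² + k₁ |v¹ₙ′|² + ρ₂ λₙ² |v³ₙ|² + k₂ |v³ₙ′|² + k₃ |v⁵ₙ′|² ) dx + ∫_{α₂}^{L} ( ρ₁ λₙ² |v¹ₙ|² + k₁ |v¹ₙ′|² + ρ₂ λₙ² |v³ₙ|² + k₂ |v³ₙ′|² + k₃ |v⁵ₙ′|² ) dx + ρ₁ λₙ² ∫_β^L |v⁵ₙ|² dx. If (H3) holds, then for every ε with 0 < ε < β/12: Jₙ(6ε, β−6ε) → 0 as n → ∞. -/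

import Mathlib

open Set Filter MeasureTheory

noncomputable section

/-- The resolvent-sequence setting for the locally damped Bresse system with
parameter `ℓ`: a sequence of nonzero frequencies `lam n` with `|lam n| → ∞`,
solutions `Uₙ = (v1,…,v6)` and right-hand sides `Fₙ = (f1,…,f6)` of the resolvent
equations `(lam n)^ℓ (i (lam n) I − 𝒜) Uₙ = Fₙ`, with `‖Uₙ‖_H = 1` and `‖Fₙ‖_H → 0`. -/
structure BresseSetting (ρ₁ ρ₂ k₁ k₂ k₃ l L β a₀ : ℝ) (ℓ : ℕ) where
  lam : ℕ → ℝ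
  v1 : ℕ → ℝ → ℂ
  v2 : ℕ → ℝ → ℂ
  v3 : ℕ → ℝ → ℂ
  v4 : ℕ → ℝ → ℂ
  v5 : ℕ → ℝ → ℂ
  v6 : ℕ → ℝ → ℂ
  f1 : ℕ → ℝ → ℂ
  f2 : ℕ → ℝ → ℂ
  f3 : ℕ → ℝ → ℂ
  f4 : ℕ → ℝ → ℂ
  f5 : ℕ → ℝ → ℂ
  f6 : ℕ → ℝ → ℂ
  lam_ne : ∀ n, lam n ≠ 0
  lam_tendsto : Tendsto (fun n => |lam n|) atTop atTop
  reg_v1 : ∀ n, ContDiffOn ℝ 2 (v1 n) (Icc 0 L)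
  reg_v3 : ∀ n, ContDiffOn ℝ 2 (v3 n) (Icc 0 L)
  reg_v5 : ∀ n, ContDiffOn ℝ 1 (v5 n) (Icc 0 L)
  reg_v5_left : ∀ n, ContDiffOn ℝ 2 (v5 n) (Icc 0 β)
  reg_v5_right : ∀ n, ContDiffOn ℝ 2 (v5 n) (Icc β L)
  reg_v2 : ∀ n, ContDiffOn ℝ 1 (v2 n) (Icc 0 L)
  reg_v4 : ∀ n, ContDiffOn ℝ 1 (v4 n) (Icc 0 L)
  reg_v6 : ∀ n, ContDiffOn ℝ 1 (v6 n) (Icc 0 L)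
  reg_f1 : ∀ n, ContDiffOn ℝ 1 (f1 n) (Icc 0 L)
  reg_f3 : ∀ n, ContDiffOn ℝ 1 (f3 n) (Icc 0 L)
  reg_f5 : ∀ n, ContDiffOn ℝ 1 (f5 n) (Icc 0 L)
  reg_f2 : ∀ n, ContinuousOn (f2 n) (Icc 0 L)
  reg_f4 : ∀ n, ContinuousOn (f4 n) (Icc 0 L)
  reg_f6 : ∀ n, ContinuousOn (f6 n) (Icc 0 L)
  bc_zero : ∀ n, v1 n 0 = 0 ∧ v2 n 0 = 0 ∧ v3 n 0 = 0 ∧ v4 n 0 = 0 ∧ v5 n 0 = 0 ∧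
      v6 n 0 = 0 ∧ f1 n 0 = 0 ∧ f3 n 0 = 0 ∧ f5 n 0 = 0
  bc_L : ∀ n, v1 n L = 0 ∧ v2 n L = 0 ∧ v3 n L = 0 ∧ v4 n L = 0 ∧ v5 n L = 0 ∧
      v6 n L = 0 ∧ f1 n L = 0 ∧ f3 n L = 0 ∧ f5 n L = 0
  eq1 : ∀ n, ∀ x ∈ Ioo (0 : ℝ) β ∪ Ioo β L,
      Complex.I * (lam n : ℂ) * v1 n x - v2 n x = (lam n : ℂ) ^ (-(ℓ : ℤ)) * f1 n x
  eq2 : ∀ n, ∀ x ∈ Ioo (0 : ℝ) β ∪ Ioo β L,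
      Complex.I * (lam n : ℂ) * (ρ₁ : ℂ) * v2 n x
        - (k₁ : ℂ) * deriv (fun y => deriv (v1 n) y + v3 n y + (l : ℂ) * v5 n y) x
        - (l : ℂ) * (k₃ : ℂ) * (deriv (v5 n) x - (l : ℂ) * v1 n x)
        = (ρ₁ : ℂ) * (lam n : ℂ) ^ (-(ℓ : ℤ)) * f2 n x
  eq3 : ∀ n, ∀ x ∈ Ioo (0 : ℝ) β ∪ Ioo β L,
      Complex.I * (lam n : ℂ) * v3 n x - v4 n x = (lam n : ℂ) ^ (-(ℓ : ℤ)) * f3 n x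
  eq4 : ∀ n, ∀ x ∈ Ioo (0 : ℝ) β ∪ Ioo β L,
      Complex.I * (lam n : ℂ) * (ρ₂ : ℂ) * v4 n x
        - (k₂ : ℂ) * deriv (deriv (v3 n)) x
        + (k₁ : ℂ) * (deriv (v1 n) x + v3 n x + (l : ℂ) * v5 n x)
        = (ρ₂ : ℂ) * (lam n : ℂ) ^ (-(ℓ : ℤ)) * f4 n x
  eq5 : ∀ n, ∀ x ∈ Ioo (0 : ℝ) β ∪ Ioo β L,
      Complex.I * (lam n : ℂ) * v5 n x - v6 n x = (lam n : ℂ) ^ (-(ℓ : ℤ)) * f5 n x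
  eq6 : ∀ n, ∀ x ∈ Ioo (0 : ℝ) β ∪ Ioo β L,
      Complex.I * (lam n : ℂ) * (ρ₁ : ℂ) * v6 n x
        - (k₃ : ℂ) * deriv (fun y => deriv (v5 n) y - (l : ℂ) * v1 n y) x
        + (l : ℂ) * (k₁ : ℂ) * (deriv (v1 n) x + v3 n x + (l : ℂ) * v5 n x)
        + (if x < β then (a₀ : ℂ) else 0) * v6 n x
        = (ρ₁ : ℂ) * (lam n : ℂ) ^ (-(ℓ : ℤ)) * f6 n x
  normU : ∀ n, (∫ x in (0 : ℝ)..L,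
      (k₁ * ‖deriv (v1 n) x + v3 n x + (l : ℂ) * v5 n x‖ ^ 2 + ρ₁ * ‖v2 n x‖ ^ 2
        + k₂ * ‖deriv (v3 n) x‖ ^ 2 + ρ₂ * ‖v4 n x‖ ^ 2
        + k₃ * ‖deriv (v5 n) x - (l : ℂ) * v1 n x‖ ^ 2 + ρ₁ * ‖v6 n x‖ ^ 2)) = 1
  normF : Tendsto (fun n => ∫ x in (0 : ℝ)..L,
      (k₁ * ‖deriv (f1 n) x + f3 n x + (l : ℂ) * f5 n x‖ ^ 2 + ρ₁ * ‖f2 n x‖ ^ 2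
        + k₂ * ‖deriv (f3 n) x‖ ^ 2 + ρ₂ * ‖f4 n x‖ ^ 2
        + k₃ * ‖deriv (f5 n) x - (l : ℂ) * f1 n x‖ ^ 2 + ρ₁ * ‖f6 n x‖ ^ 2))
      atTop (nhds 0)

/-! ### Toolkit: `L¹`-small, `L²`-small and `L²`-bounded sequences of continuous functions -/

/-- continuous and tending to zero in `L¹(c,d)` -/
def ZS (c d : ℝ) (f : ℕ → ℝ → ℝ) : Prop :=
  (∀ n, ContinuousOn (f n) (Icc c d)) ∧
    Tendsto (fun n => ∫ x in c..d, |f n x|) atTop (nhds 0)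

/-- continuous and tending to zero in `L²(c,d)` -/
def S2 {E : Type} [NormedAddCommGroup E] (c d : ℝ) (f : ℕ → ℝ → E) : Prop :=
  (∀ n, ContinuousOn (f n) (Icc c d)) ∧
    Tendsto (fun n => ∫ x in c..d, ‖f n x‖ ^ 2) atTop (nhds 0)

/-- continuous and bounded in `L²(c,d)` -/
def B2 {E : Type} [NormedAddCommGroup E] (c d : ℝ) (f : ℕ → ℝ → E) : Prop :=
  (∀ n, ContinuousOn (f n) (Icc c d)) ∧
    ∃ C : ℝ, ∀ n, ∫ x in c..d, ‖f n x‖ ^ 2 ≤ C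

lemma cint {E : Type} [NormedAddCommGroup E] {c d : ℝ} (h : c ≤ d) {f : ℝ → E}
    (hf : ContinuousOn f (Icc c d)) : IntervalIntegrable f volume c d := by
  apply ContinuousOn.intervalIntegrable
  rwa [uIcc_of_le h]

lemma int_mono {c d : ℝ} (h : c ≤ d) {f g : ℝ → ℝ}
    (hf : ContinuousOn f (Icc c d)) (hg : ContinuousOn g (Icc c d))
    (hfg : ∀ x ∈ Icc c d, f x ≤ g x) : ∫ x in c..d, f x ≤ ∫ x in c..d, g x :=
  intervalIntegral.integral_mono_on h (cint h hf) (cint h hg) hfg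

lemma int_nonneg {c d : ℝ} (h : c ≤ d) {f : ℝ → ℝ}
    (hfg : ∀ x ∈ Icc c d, 0 ≤ f x) : 0 ≤ ∫ x in c..d, f x :=
  intervalIntegral.integral_nonneg h hfg

lemma ZS.of_le {c d : ℝ} (h : c ≤ d) {f g : ℕ → ℝ → ℝ} (hg : ZS c d g)
    (hf : ∀ n, ContinuousOn (f n) (Icc c d))
    (hfg : ∀ n, ∀ x ∈ Icc c d, |f n x| ≤ |g n x|) : ZS c d f := by
  refine ⟨hf, squeeze_zero (fun n => int_nonneg h fun x _ => abs_nonneg _) (fun n => ?_) hg.2⟩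
  exact int_mono h (hf n).abs (hg.1 n).abs (hfg n)

lemma ZS.congr {c d : ℝ} (h : c ≤ d) {f g : ℕ → ℝ → ℝ} (hg : ZS c d g)
    (hfg : ∀ n, ∀ x ∈ Icc c d, g n x = f n x) : ZS c d f :=
  hg.of_le h (fun n => (hg.1 n).congr fun x hx => (hfg n x hx).symm)
    (fun n x hx => by rw [hfg n x hx])

lemma ZS.add {c d : ℝ} (h : c ≤ d) {f g : ℕ → ℝ → ℝ} (hf : ZS c d f) (hg : ZS c d g) :
    ZS c d (fun n x => f n x + g n x) := by
  have hc : ∀ n, ContinuousOn (fun x => f n x + g n x) (Icc c d) :=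
    fun n => (hf.1 n).add (hg.1 n)
  refine ⟨hc, squeeze_zero (fun n => int_nonneg h fun x _ => abs_nonneg _) (fun n => ?_)
    (by simpa using hf.2.add hg.2)⟩
  rw [← intervalIntegral.integral_add (cint h (hf.1 n).abs) (cint h (hg.1 n).abs)]
  exact int_mono h (hc n).abs ((hf.1 n).abs.add (hg.1 n).abs) fun x _ => abs_add_le _ _

lemma ZS.smul {c d : ℝ} {f : ℕ → ℝ → ℝ} (hf : ZS c d f) (r : ℝ) :
    ZS c d (fun n x => r * f n x) := by
  refine ⟨fun n => continuousOn_const.mul (hf.1 n), ?_⟩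
  simp only [abs_mul, intervalIntegral.integral_const_mul]
  simpa using hf.2.const_mul |r|

lemma cont_bound {c d : ℝ} {t : ℝ → ℝ} (ht : ContinuousOn t (Icc c d)) :
    ∃ M : ℝ, 0 ≤ M ∧ ∀ x ∈ Icc c d, |t x| ≤ M := by
  obtain ⟨M, hM⟩ := isCompact_Icc.exists_bound_of_continuousOn ht
  exact ⟨max M 0, le_max_right _ _, fun x hx => (hM x hx).trans (le_max_left _ _)⟩

lemma ZS.mulf {c d : ℝ} (h : c ≤ d) {f : ℕ → ℝ → ℝ} (hf : ZS c d f) {t : ℝ → ℝ}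
    (ht : ContinuousOn t (Icc c d)) : ZS c d (fun n x => t x * f n x) := by
  obtain ⟨M, hM0, hM⟩ := cont_bound ht
  refine (hf.smul M).of_le h (fun n => ht.mul (hf.1 n)) fun n x hx => ?_
  rw [abs_mul, abs_mul, abs_of_nonneg hM0]
  exact mul_le_mul_of_nonneg_right (hM x hx) (abs_nonneg _)

section
variable {E : Type} [NormedAddCommGroup E]

lemma S2.of_le {F : Type} [NormedAddCommGroup F] {c d : ℝ} (h : c ≤ d) {f : ℕ → ℝ → F}
    {g : ℕ → ℝ → E} (hg : S2 c d g)
    (hf : ∀ n, ContinuousOn (f n) (Icc c d)) (M : ℝ)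
    (hfg : ∀ n, ∀ x ∈ Icc c d, ‖f n x‖ ≤ M * ‖g n x‖) : S2 c d f := by
  refine ⟨hf, squeeze_zero (fun n => int_nonneg h fun x _ => sq_nonneg _) (fun n => ?_)
    (by simpa using hg.2.const_mul (M ^ 2))⟩
  rw [← intervalIntegral.integral_const_mul]
  refine int_mono h ((hf n).norm.pow 2) (continuousOn_const.mul ((hg.1 n).norm.pow 2)) ?_
  intro x hx
  rw [← mul_pow]
  exact pow_le_pow_left₀ (norm_nonneg _) (hfg n x hx) 2

lemma B2.of_le {F : Type} [NormedAddCommGroup F] {c d : ℝ} (h : c ≤ d) {f : ℕ → ℝ → F}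
    {g : ℕ → ℝ → E} (hg : B2 c d g)
    (hf : ∀ n, ContinuousOn (f n) (Icc c d)) (M : ℝ)
    (hfg : ∀ n, ∀ x ∈ Icc c d, ‖f n x‖ ≤ M * ‖g n x‖) : B2 c d f := by
  obtain ⟨C, hC⟩ := hg.2
  refine ⟨hf, M ^ 2 * C, fun n => ?_⟩
  refine le_trans ?_ (mul_le_mul_of_nonneg_left (hC n) (sq_nonneg M))
  rw [← intervalIntegral.integral_const_mul]
  refine int_mono h ((hf n).norm.pow 2) (continuousOn_const.mul ((hg.1 n).norm.pow 2)) ?_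
  intro x hx
  rw [← mul_pow]
  exact pow_le_pow_left₀ (norm_nonneg _) (hfg n x hx) 2

lemma S2.toB2 {c d : ℝ} {f : ℕ → ℝ → E} (hf : S2 c d f) : B2 c d f := by
  obtain ⟨C, hC⟩ := hf.2.bddAbove_range
  exact ⟨hf.1, C, fun n => hC ⟨n, rfl⟩⟩

lemma nsq_add (a b : E) : ‖a + b‖ ^ 2 ≤ 2 * ‖a‖ ^ 2 + 2 * ‖b‖ ^ 2 := by
  nlinarith [norm_add_le a b, sq_nonneg (‖a‖ - ‖b‖), norm_nonneg (a + b), norm_nonneg a,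
    norm_nonneg b]

lemma int_nsq_add {c d : ℝ} (h : c ≤ d) {f g : ℝ → E} (hf : ContinuousOn f (Icc c d))
    (hg : ContinuousOn g (Icc c d)) :
    ∫ x in c..d, ‖f x + g x‖ ^ 2 ≤
      2 * (∫ x in c..d, ‖f x‖ ^ 2) + 2 * (∫ x in c..d, ‖g x‖ ^ 2) := by
  have h1 : ContinuousOn (fun x => 2 * ‖f x‖ ^ 2) (Icc c d) :=
    continuousOn_const.mul (hf.norm.pow 2)
  have h2 : ContinuousOn (fun x => 2 * ‖g x‖ ^ 2) (Icc c d) :=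
    continuousOn_const.mul (hg.norm.pow 2)
  rw [← intervalIntegral.integral_const_mul, ← intervalIntegral.integral_const_mul,
    ← intervalIntegral.integral_add (cint h h1) (cint h h2)]
  exact int_mono h ((hf.add hg).norm.pow 2) (h1.add h2) fun x _ => nsq_add _ _

lemma S2.add {c d : ℝ} (h : c ≤ d) {f g : ℕ → ℝ → E} (hf : S2 c d f) (hg : S2 c d g) :
    S2 c d (fun n x => f n x + g n x) := by
  refine ⟨fun n => (hf.1 n).add (hg.1 n),
    squeeze_zero (fun n => int_nonneg h fun x _ => sq_nonneg _)
    (fun n => int_nsq_add h (hf.1 n) (hg.1 n))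
    (by simpa using (hf.2.const_mul 2).add (hg.2.const_mul 2))⟩

lemma B2.add {c d : ℝ} (h : c ≤ d) {f g : ℕ → ℝ → E} (hf : B2 c d f) (hg : B2 c d g) :
    B2 c d (fun n x => f n x + g n x) := by
  obtain ⟨C, hC⟩ := hf.2
  obtain ⟨D, hD⟩ := hg.2
  refine ⟨fun n => (hf.1 n).add (hg.1 n), 2 * C + 2 * D, fun n => ?_⟩
  have := int_nsq_add h (hf.1 n) (hg.1 n)
  linarith [hC n, hD n]

lemma S2.congr {c d : ℝ} (h : c ≤ d) {f g : ℕ → ℝ → E} (hg : S2 c d g)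
    (hf : ∀ n, ContinuousOn (f n) (Icc c d))
    (hfg : ∀ n, ∀ x ∈ Ioo c d, g n x = f n x) : S2 c d f := by
  refine ⟨hf, hg.2.congr fun n => ?_⟩
  exact intervalIntegral.integral_congr_Ioo_of_le h fun x hx => by
    simp only [hfg n x hx]

lemma B2.congr {c d : ℝ} (h : c ≤ d) {f g : ℕ → ℝ → E} (hg : B2 c d g)
    (hf : ∀ n, ContinuousOn (f n) (Icc c d))
    (hfg : ∀ n, ∀ x ∈ Ioo c d, g n x = f n x) : B2 c d f := by
  obtain ⟨C, hC⟩ := hg.2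
  refine ⟨hf, C, fun n => (le_of_eq ?_).trans (hC n)⟩
  exact intervalIntegral.integral_congr_Ioo_of_le h fun x hx => by
    simp only [hfg n x hx]

lemma S2.mono {a b c d : ℝ} (hac : a ≤ c) (h : c ≤ d) (hdb : d ≤ b) {f : ℕ → ℝ → E}
    (hf : S2 a b f) : S2 c d f := by
  refine ⟨fun n => (hf.1 n).mono (Icc_subset_Icc hac hdb),
    squeeze_zero (fun n => int_nonneg h fun x _ => sq_nonneg _) (fun n => ?_) hf.2⟩
  exact intervalIntegral.integral_mono_interval hac h hdb
    (Eventually.of_forall fun x => sq_nonneg _)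
    (cint (hac.trans (h.trans hdb)) ((hf.1 n).norm.pow 2))

lemma B2.mono {a b c d : ℝ} (hac : a ≤ c) (h : c ≤ d) (hdb : d ≤ b) {f : ℕ → ℝ → E}
    (hf : B2 a b f) : B2 c d f := by
  obtain ⟨C, hC⟩ := hf.2
  refine ⟨fun n => (hf.1 n).mono (Icc_subset_Icc hac hdb), C, fun n => le_trans ?_ (hC n)⟩
  exact intervalIntegral.integral_mono_interval hac h hdb
    (Eventually.of_forall fun x => sq_nonneg _)
    (cint (hac.trans (h.trans hdb)) ((hf.1 n).norm.pow 2))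

variable [NormedSpace ℝ E]

lemma B2.scale {c d : ℝ} (h : c ≤ d) {f : ℕ → ℝ → E} (hf : B2 c d f) {m : ℕ → ℝ}
    (hm : Tendsto m atTop (nhds 0)) : S2 c d (fun n x => m n • f n x) := by
  obtain ⟨C, hC⟩ := hf.2
  refine ⟨fun n => (hf.1 n).const_smul _,
    squeeze_zero (g := fun n => m n ^ 2 * C) (fun n => int_nonneg h fun x _ => sq_nonneg _)
    (fun n => ?_) (by simpa using (hm.pow 2).mul_const C)⟩
  simp only [norm_smul, mul_pow, intervalIntegral.integral_const_mul, Real.norm_eq_abs, sq_abs]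
  exact mul_le_mul_of_nonneg_left (hC n) (sq_nonneg _)

lemma B2.scaler {c d : ℝ} (h : c ≤ d) {f : ℕ → ℝ → ℝ} (hf : B2 c d f) {m : ℕ → ℝ}
    (hm : Tendsto m atTop (nhds 0)) : S2 c d (fun n x => m n * f n x) := hf.scale h hm

lemma S2.smul {c d : ℝ} (h : c ≤ d) {f : ℕ → ℝ → E} (hf : S2 c d f) (r : ℝ) :
    S2 c d (fun n x => r • f n x) :=
  hf.of_le h (fun n => (hf.1 n).const_smul _) |r| fun n x _ => by
    rw [norm_smul, Real.norm_eq_abs]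

lemma B2.smul {c d : ℝ} (h : c ≤ d) {f : ℕ → ℝ → E} (hf : B2 c d f) (r : ℝ) :
    B2 c d (fun n x => r • f n x) :=
  hf.of_le h (fun n => (hf.1 n).const_smul _) |r| fun n x _ => by
    rw [norm_smul, Real.norm_eq_abs]

lemma S2.mulf {c d : ℝ} (h : c ≤ d) {f : ℕ → ℝ → ℝ} (hf : S2 c d f) {t : ℝ → ℝ}
    (ht : ContinuousOn t (Icc c d)) : S2 c d (fun n x => t x * f n x) := by
  obtain ⟨M, hM0, hM⟩ := cont_bound ht
  refine hf.of_le h (fun n => ht.mul (hf.1 n)) M fun n x hx => ?_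
  rw [norm_mul]
  exact mul_le_mul_of_nonneg_right (hM x hx) (norm_nonneg _)

lemma S2.mulB {c d : ℝ} (h : c ≤ d) {f g : ℕ → ℝ → ℝ} (hf : S2 c d f) (hg : B2 c d g) :
    ZS c d (fun n x => f n x * g n x) := by
  obtain ⟨C, hC⟩ := hg.2
  refine ⟨fun n => (hf.1 n).mul (hg.1 n), ?_⟩
  set A : ℕ → ℝ := fun n => ∫ x in c..d, ‖f n x‖ ^ 2 with hA
  have hA0 : ∀ n, 0 ≤ A n := fun n => int_nonneg h fun x _ => sq_nonneg _
  set t : ℕ → ℝ := fun n => Real.sqrt (A n) + 1 / ((n : ℝ) + 1) with ht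
  have htpos : ∀ n, 0 < t n := fun n => by
    have : 0 < 1 / ((n : ℝ) + 1) := by positivity
    have := Real.sqrt_nonneg (A n)
    simp only [ht]; linarith
  have hsq : Tendsto (fun n => Real.sqrt (A n)) atTop (nhds 0) := by
    have := hf.2.sqrt
    rwa [Real.sqrt_zero] at this
  have ht0 : Tendsto t atTop (nhds 0) := by
    have := hsq.add (tendsto_one_div_add_atTop_nhds_zero_nat (𝕜 := ℝ))
    rwa [add_zero] at this
  refine squeeze_zero (g := fun n => Real.sqrt (A n) + t n * C)
    (fun n => int_nonneg h fun x _ => abs_nonneg _) (fun n => ?_)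
    (by simpa using hsq.add (ht0.mul_const C))
  have h1 : ContinuousOn (fun x => (t n)⁻¹ * ‖f n x‖ ^ 2) (Icc c d) :=
    continuousOn_const.mul ((hf.1 n).norm.pow 2)
  have h2 : ContinuousOn (fun x => t n * ‖g n x‖ ^ 2) (Icc c d) :=
    continuousOn_const.mul ((hg.1 n).norm.pow 2)
  have key : ∫ x in c..d, |f n x * g n x| ≤ ∫ x in c..d, ((t n)⁻¹ * ‖f n x‖ ^ 2
      + t n * ‖g n x‖ ^ 2) := by
    refine int_mono h ((hf.1 n).mul (hg.1 n)).abs (h1.add h2) fun x _ => ?_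
    rw [abs_mul, Real.norm_eq_abs, Real.norm_eq_abs]
    have hT := htpos n
    have e : (t n)⁻¹ * |f n x| ^ 2 + t n * |g n x| ^ 2 - 2 * (|f n x| * |g n x|)
        = (t n)⁻¹ * (|f n x| - t n * |g n x|) ^ 2 := by
      field_simp
      ring
    have : 0 ≤ (t n)⁻¹ * (|f n x| - t n * |g n x|) ^ 2 := by positivity
    have : 0 ≤ |f n x| * |g n x| := by positivity
    linarith
  rw [intervalIntegral.integral_add (cint h h1) (cint h h2), intervalIntegral.integral_const_mul,
    intervalIntegral.integral_const_mul] at key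
  have h3 : (t n)⁻¹ * A n ≤ Real.sqrt (A n) := by
    rw [inv_mul_le_iff₀ (htpos n)]
    have hs := Real.mul_self_sqrt (hA0 n)
    have : Real.sqrt (A n) ≤ t n := by
      have : 0 < 1 / ((n : ℝ) + 1) := by positivity
      simp only [ht]; linarith
    nlinarith [Real.sqrt_nonneg (A n)]
  have h4 := mul_le_mul_of_nonneg_left (hC n) (htpos n).le
  linarith

end

lemma ZS.tendsto {c d : ℝ} (h : c ≤ d) {f : ℕ → ℝ → ℝ} (hf : ZS c d f) :
    Tendsto (fun n => ∫ x in c..d, f n x) atTop (nhds 0) := by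
  refine squeeze_zero_norm (fun n => ?_) hf.2
  exact intervalIntegral.abs_integral_le_integral_abs h

lemma S2.of_sq {c d : ℝ} {f g : ℕ → ℝ → ℝ} (h : c ≤ d)
    (hf : ∀ n, ContinuousOn (f n) (Icc c d))
    (hg : Tendsto (fun n => ∫ x in c..d, g n x) atTop (nhds 0))
    (hfg : ∀ n, ∀ x ∈ Icc c d, g n x = f n x ^ 2) : S2 c d f := by
  refine ⟨hf, hg.congr fun n => ?_⟩
  refine intervalIntegral.integral_congr fun x hx => ?_
  rw [uIcc_of_le h] at hx
  simp only [hfg n x hx, Real.norm_eq_abs, sq_abs]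

/-- FTC in asymptotic form -/
lemma ftc_tendsto {c d : ℝ} (h : c ≤ d) {H m r : ℕ → ℝ → ℝ}
    (hH : ∀ n, ContinuousOn (H n) (Icc c d)) (hc : ∀ n, H n c = 0) (hd : ∀ n, H n d = 0)
    (hm : ∀ n, ContinuousOn (m n) (Icc c d)) (hr : ZS c d r)
    (hder : ∀ n, ∀ x ∈ Ioo c d, HasDerivAt (H n) (m n x + r n x) x) :
    Tendsto (fun n => ∫ x in c..d, m n x) atTop (nhds 0) := by
  have := (hr.tendsto h).neg
  rw [neg_zero] at this
  refine this.congr fun n => ?_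
  have e := intervalIntegral.integral_eq_sub_of_hasDerivAt_of_le h (hH n) (hder n)
    (cint h ((hm n).add (hr.1 n)))
  rw [hc, hd, intervalIntegral.integral_add (cint h (hm n)) (cint h (hr.1 n))] at e
  linarith

lemma int_lin {c d : ℝ} (h : c ≤ d) {f g : ℝ → ℝ} (hf : ContinuousOn f (Icc c d))
    (hg : ContinuousOn g (Icc c d)) (a b : ℝ) :
    ∫ x in c..d, (a * f x + b * g x) = a * (∫ x in c..d, f x) + b * ∫ x in c..d, g x := by
  rw [intervalIntegral.integral_add ((cint h hf).const_mul a) ((cint h hg).const_mul b),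
    intervalIntegral.integral_const_mul, intervalIntegral.integral_const_mul]

/-- The reduced (real) second order system on an interval `[c,d]`. -/
structure Red (ρ₁ ρ₂ k₁ k₂ k₃ l c d : ℝ) (lam : ℕ → ℝ)
    (v1 v3 v5 p1 p3 p5 g1 g2 g3 : ℕ → ℝ → ℝ) : Prop where
  hcd : c ≤ d
  lam_ne : ∀ n, lam n ≠ 0
  mu : Tendsto (fun n => (lam n)⁻¹) atTop (nhds 0)
  cv1 : ∀ n, ContinuousOn (v1 n) (Icc c d)
  cv3 : ∀ n, ContinuousOn (v3 n) (Icc c d)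
  cv5 : ∀ n, ContinuousOn (v5 n) (Icc c d)
  by1 : B2 c d (fun n x => lam n * v1 n x)
  by3 : B2 c d (fun n x => lam n * v3 n x)
  by5 : B2 c d (fun n x => lam n * v5 n x)
  bp1 : B2 c d p1
  bp3 : B2 c d p3
  bp5 : B2 c d p5
  sg1 : S2 c d g1
  sg2 : S2 c d g2
  cg3 : ∀ n, ContinuousOn (g3 n) (Icc c d)
  slg3 : S2 c d (fun n x => lam n * g3 n x)
  dv1 : ∀ n, ∀ x ∈ Ioo c d, HasDerivAt (v1 n) (p1 n x) x
  dv3 : ∀ n, ∀ x ∈ Ioo c d, HasDerivAt (v3 n) (p3 n x) x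
  dv5 : ∀ n, ∀ x ∈ Ioo c d, HasDerivAt (v5 n) (p5 n x) x
  dp1 : ∀ n, ∀ x ∈ Ioo c d, HasDerivAt (p1 n)
    ((-ρ₁ * lam n ^ 2 * v1 n x - k₁ * p3 n x - l * (k₁ + k₃) * p5 n x
      + l ^ 2 * k₃ * v1 n x + g1 n x) / k₁) x
  dp3 : ∀ n, ∀ x ∈ Ioo c d, HasDerivAt (p3 n)
    ((-ρ₂ * lam n ^ 2 * v3 n x + k₁ * (p1 n x + v3 n x + l * v5 n x) + g2 n x) / k₂) x
  dp5 : ∀ n, ∀ x ∈ Ioo c d, HasDerivAt (p5 n)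
    ((-ρ₁ * lam n ^ 2 * v5 n x + l * (k₁ + k₃) * p1 n x + l * k₁ * (v3 n x + l * v5 n x)
      + g3 n x) / k₃) x

namespace Red

variable {ρ₁ ρ₂ k₁ k₂ k₃ l c d : ℝ} {lam : ℕ → ℝ}
    {v1 v3 v5 p1 p3 p5 g1 g2 g3 : ℕ → ℝ → ℝ}

lemma descale {c d : ℝ} (h : c ≤ d) {lam : ℕ → ℝ} (hne : ∀ n, lam n ≠ 0)
    (mu : Tendsto (fun n => (lam n)⁻¹) atTop (nhds 0)) {f g : ℕ → ℝ → ℝ} (hf : B2 c d f)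
    (hfg : ∀ n x, f n x = lam n * g n x) : S2 c d g := by
  have e : g = fun n x => (lam n)⁻¹ * f n x := by
    funext n x
    rw [hfg, inv_mul_cancel_left₀ (hne n)]
  rw [e]
  exact hf.scaler h mu

lemma sv1 (R : Red ρ₁ ρ₂ k₁ k₂ k₃ l c d lam v1 v3 v5 p1 p3 p5 g1 g2 g3) : S2 c d v1 :=
  descale R.hcd R.lam_ne R.mu R.by1 fun _ _ => rfl
lemma sv3 (R : Red ρ₁ ρ₂ k₁ k₂ k₃ l c d lam v1 v3 v5 p1 p3 p5 g1 g2 g3) : S2 c d v3 :=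
  descale R.hcd R.lam_ne R.mu R.by3 fun _ _ => rfl
lemma sv5 (R : Red ρ₁ ρ₂ k₁ k₂ k₃ l c d lam v1 v3 v5 p1 p3 p5 g1 g2 g3) : S2 c d v5 :=
  descale R.hcd R.lam_ne R.mu R.by5 fun _ _ => rfl
lemma sg3 (R : Red ρ₁ ρ₂ k₁ k₂ k₃ l c d lam v1 v3 v5 p1 p3 p5 g1 g2 g3) : S2 c d g3 :=
  descale R.hcd R.lam_ne R.mu R.slg3.toB2 fun _ _ => rfl

/-- the energy density -/
def EN (ρ₁ ρ₂ k₁ k₂ k₃ : ℝ) (lam : ℕ → ℝ) (v1 v3 v5 p1 p3 p5 : ℕ → ℝ → ℝ) (n : ℕ) (x : ℝ) : ℝ :=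
  ρ₁ * lam n ^ 2 * v1 n x ^ 2 + k₁ * p1 n x ^ 2 + ρ₂ * lam n ^ 2 * v3 n x ^ 2
    + k₂ * p3 n x ^ 2 + k₃ * p5 n x ^ 2 + ρ₁ * lam n ^ 2 * v5 n x ^ 2

lemma contE (R : Red ρ₁ ρ₂ k₁ k₂ k₃ l c d lam v1 v3 v5 p1 p3 p5 g1 g2 g3) (n : ℕ) :
    ContinuousOn (EN ρ₁ ρ₂ k₁ k₂ k₃ lam v1 v3 v5 p1 p3 p5 n) (Icc c d) := by
  have h1 := R.cv1 n
  have h2 := R.cv3 n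
  have h3 := R.cv5 n
  have h4 := R.bp1.1 n
  have h5 := R.bp3.1 n
  have h6 := R.bp5.1 n
  unfold EN
  fun_prop

/-- the energy is almost constant in `x` -/
lemma osc (R : Red ρ₁ ρ₂ k₁ k₂ k₃ l c d lam v1 v3 v5 p1 p3 p5 g1 g2 g3)
    (hk1 : 0 < k₁) (hk2 : 0 < k₂) (hk3 : 0 < k₃) :
    ∃ δ : ℕ → ℝ, Tendsto δ atTop (nhds 0) ∧ ∀ n, ∀ x ∈ Icc c d, ∀ y ∈ Icc c d,
      EN ρ₁ ρ₂ k₁ k₂ k₃ lam v1 v3 v5 p1 p3 p5 n y ≤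
        EN ρ₁ ρ₂ k₁ k₂ k₃ lam v1 v3 v5 p1 p3 p5 n x + δ n := by
  have hZ := (((((((((R.sv1.mulB R.hcd R.bp1).smul (2 * l ^ 2 * k₃)).add R.hcd
    ((R.sg1.mulB R.hcd R.bp1).smul 2)).add R.hcd
    ((R.sv3.mulB R.hcd R.bp3).smul (2 * k₁))).add R.hcd
    ((R.sv5.mulB R.hcd R.bp3).smul (2 * k₁ * l))).add R.hcd
    ((R.sg2.mulB R.hcd R.bp3).smul 2)).add R.hcd
    ((R.sv3.mulB R.hcd R.bp5).smul (2 * k₁ * l))).add R.hcd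
    ((R.sv5.mulB R.hcd R.bp5).smul (2 * k₁ * l ^ 2))).add R.hcd
    ((R.sg3.mulB R.hcd R.bp5).smul 2))
  set r : ℕ → ℝ → ℝ := fun n x => 2 * l ^ 2 * k₃ * (v1 n x * p1 n x) + 2 * (g1 n x * p1 n x)
    + 2 * k₁ * (v3 n x * p3 n x) + 2 * k₁ * l * (v5 n x * p3 n x) + 2 * (g2 n x * p3 n x)
    + 2 * k₁ * l * (v3 n x * p5 n x) + 2 * k₁ * l ^ 2 * (v5 n x * p5 n x)
    + 2 * (g3 n x * p5 n x) with hr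
  have hder : ∀ n, ∀ x ∈ Ioo c d,
      HasDerivAt (EN ρ₁ ρ₂ k₁ k₂ k₃ lam v1 v3 v5 p1 p3 p5 n) (r n x) x := by
    intro n x hx
    have := ((((((((R.dv1 n x hx).pow 2).const_mul (ρ₁ * lam n ^ 2))).add
      (((R.dp1 n x hx).pow 2).const_mul k₁)).add
      (((R.dv3 n x hx).pow 2).const_mul (ρ₂ * lam n ^ 2))).add
      (((R.dp3 n x hx).pow 2).const_mul k₂)).add
      (((R.dp5 n x hx).pow 2).const_mul k₃)).add
      (((R.dv5 n x hx).pow 2).const_mul (ρ₁ * lam n ^ 2))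
    refine this.congr_deriv ?_
    simp only [hr]
    push_cast
    field_simp
    ring
  have key : ∀ n, ∀ x ∈ Icc c d, ∀ y ∈ Icc c d, x ≤ y →
      |EN ρ₁ ρ₂ k₁ k₂ k₃ lam v1 v3 v5 p1 p3 p5 n y -
        EN ρ₁ ρ₂ k₁ k₂ k₃ lam v1 v3 v5 p1 p3 p5 n x| ≤ ∫ x in c..d, |r n x| := by
    intro n x hx y hy hxy
    have hsub : Icc x y ⊆ Icc c d := Icc_subset_Icc hx.1 hy.2
    have e := intervalIntegral.integral_eq_sub_of_hasDerivAt_of_le hxy ((R.contE n).mono hsub)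
      (fun z hz => hder n z ⟨hx.1.trans_lt hz.1, hz.2.trans_le hy.2⟩)
      (cint hxy ((hZ.1 n).mono hsub))
    rw [← e]
    refine (intervalIntegral.abs_integral_le_integral_abs hxy).trans ?_
    exact intervalIntegral.integral_mono_interval hx.1 hxy hy.2
      (Eventually.of_forall fun x => abs_nonneg _) (cint R.hcd (hZ.1 n).abs)
  refine ⟨fun n => ∫ x in c..d, |r n x|, hZ.2, fun n x hx y hy => ?_⟩
  rcases le_total x y with hxy | hxy
  · have := (abs_le.1 (key n x hx y hy hxy)).2
    linarith
  · have := (abs_le.1 (key n y hy x hx hxy)).1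
    linarith

/-- On the damped interval everything is small with the weight `(x(d-x))²`. -/
lemma local_small (R : Red ρ₁ ρ₂ k₁ k₂ k₃ l 0 d lam v1 v3 v5 p1 p3 p5 g1 g2 g3)
    (hr1 : 0 < ρ₁) (hr2 : 0 < ρ₂)
    (hk1 : 0 < k₁) (hk2 : 0 < k₂) (hk3 : 0 < k₃) (hl : 0 < l)
    (hz : S2 0 d (fun n x => lam n ^ 3 * v5 n x)) :
    Tendsto (fun n => ∫ x in (0 : ℝ)..d, (x * (d - x)) ^ 2 *
      EN ρ₁ ρ₂ k₁ k₂ k₃ lam v1 v3 v5 p1 p3 p5 n x) atTop (nhds 0) := by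
  have h := R.hcd
  have hne := R.lam_ne
  have bl2 : S2 0 d (fun n x => lam n ^ 2 * v5 n x) :=
    descale h hne R.mu hz.toB2 fun n x => by ring
  have sy5 : S2 0 d (fun n x => lam n * v5 n x) :=
    descale h hne R.mu bl2.toB2 fun n x => by ring
  have c1 := R.cv1
  have c3 := R.cv3
  have c5 := R.cv5
  have e1 := R.bp1.1
  have e3 := R.bp3.1
  have e5 := R.bp5.1
  have cg1 := R.sg1.1
  have cg2 := R.sg2.1
  have cg3 := R.cg3
  have cw : ContinuousOn (fun x : ℝ => x * (d - x)) (Icc 0 d) := by fun_prop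
  have cw' : ContinuousOn (fun x : ℝ => d - 2 * x) (Icc 0 d) := by fun_prop
  have ct : ContinuousOn (fun x : ℝ => (x * (d - x)) ^ 2) (Icc 0 d) := by fun_prop
  have ct' : ContinuousOn (fun x : ℝ => 2 * (x * (d - x)) * (d - 2 * x)) (Icc 0 d) := by fun_prop
  have ct'' : ContinuousOn (fun x : ℝ => 2 * (d - 2 * x) ^ 2 - 4 * (x * (d - x))) (Icc 0 d) := by
    fun_prop
  have dw : ∀ x : ℝ, HasDerivAt (fun x : ℝ => x * (d - x)) (d - 2 * x) x := fun x => by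
    have := (hasDerivAt_id x).mul ((hasDerivAt_id x).const_sub d)
    refine this.congr_deriv ?_
    simp only [id]; ring
  have dt : ∀ x : ℝ, HasDerivAt (fun x : ℝ => (x * (d - x)) ^ 2)
      (2 * (x * (d - x)) * (d - 2 * x)) x := fun x => by
    refine ((dw x).pow 2).congr_deriv ?_
    push_cast; ring
  have dt' : ∀ x : ℝ, HasDerivAt (fun x : ℝ => 2 * (x * (d - x)) * (d - 2 * x))
      (2 * (d - 2 * x) ^ 2 - 4 * (x * (d - x))) x := fun x => by
    have := ((dw x).const_mul 2).mul (((hasDerivAt_id x).const_mul 2).const_sub d)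
    refine this.congr_deriv ?_
    simp only [id]; ring
  -- Step 2 : `p5` is small
  have s5 : S2 0 d (fun n x => (x * (d - x)) * p5 n x) := by
    have hT : Tendsto (fun n => ∫ x in (0 : ℝ)..d, (x * (d - x)) ^ 2 * p5 n x ^ 2)
        atTop (nhds 0) := by
      have hZ := ((((((((R.sv5.mulB h R.bp5).mulf h ct').add h
        (((sy5.mulB h sy5.toB2).mulf h ct).smul (-ρ₁ / k₃))).add h
        (((R.sv5.mulB h R.bp1).mulf h ct).smul (l * (k₁ + k₃) / k₃))).add h
        (((R.sv5.mulB h R.sv3.toB2).mulf h ct).smul (l * k₁ / k₃))).add h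
        (((R.sv5.mulB h R.sv5.toB2).mulf h ct).smul (l ^ 2 * k₁ / k₃))).add h
        (((R.sv5.mulB h R.sg3.toB2).mulf h ct).smul (1 / k₃))))
      refine ftc_tendsto h (H := fun n x => (x * (d - x)) ^ 2 * (p5 n x * v5 n x))
        (fun n => ct.mul ((e5 n).mul (c5 n))) (fun n => by simp) (fun n => by simp)
        (fun n => ct.mul ((e5 n).pow 2)) hZ fun n x hx => ?_
      refine ((dt x).mul ((R.dp5 n x hx).mul (R.dv5 n x hx))).congr_deriv ?_
      try simp only [Pi.mul_apply, Pi.add_apply, Pi.sub_apply]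
      field_simp
      ring
    exact S2.of_sq h (fun n => cw.mul (e5 n)) hT fun n x _ => by ring
  have s5t : S2 0 d (fun n x => (x * (d - x)) ^ 2 * p5 n x) :=
    (s5.mulf h cw).congr h (fun n => ct.mul (e5 n)) fun n x _ => by ring
  -- Step 3 : `p1` is small
  have s1 : S2 0 d (fun n x => (x * (d - x)) * p1 n x) := by
    have hT : Tendsto (fun n => ∫ x in (0 : ℝ)..d, l * (k₁ + k₃) / k₃ *
        ((x * (d - x)) ^ 2 * p1 n x ^ 2)) atTop (nhds 0) := by
      have hZ := ((((((((((((((s5.mulB h R.bp1).mulf h cw').smul 2).add h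
        (((bl2.mulB h R.bp1).mulf h ct).smul (-ρ₁ / k₃ + ρ₁ / k₁))).add h
        (((R.sv3.mulB h R.bp1).mulf h ct).smul (l * k₁ / k₃))).add h
        (((R.sv5.mulB h R.bp1).mulf h ct).smul (l ^ 2 * k₁ / k₃))).add h
        (((R.sg3.mulB h R.bp1).mulf h ct).smul (1 / k₃))).add h
        ((s5t.mulB h R.bp3).smul (-1))).add h
        ((s5t.mulB h R.bp5).smul (-(l * (k₁ + k₃)) / k₁))).add h
        ((s5t.mulB h R.sv1.toB2).smul (l ^ 2 * k₃ / k₁))).add h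
        ((s5t.mulB h R.sg1.toB2).smul (1 / k₁))).add h
        (((bl2.mulB h R.sv1.toB2).mulf h ct').smul (ρ₁ / k₁)))))
      refine ftc_tendsto h (H := fun n x => (x * (d - x)) ^ 2 * (p5 n x * p1 n x
        + ρ₁ / k₁ * lam n ^ 2 * (v5 n x * v1 n x)))
        (fun n => ct.mul (((e5 n).mul (e1 n)).add
          (continuousOn_const.mul ((c5 n).mul (c1 n)))))
        (fun n => by simp) (fun n => by simp)
        (fun n => continuousOn_const.mul (ct.mul ((e1 n).pow 2))) hZ fun n x hx => ?_
      refine ((dt x).mul (((R.dp5 n x hx).mul (R.dp1 n x hx)).add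
        (((R.dv5 n x hx).mul (R.dv1 n x hx)).const_mul (ρ₁ / k₁ * lam n ^ 2)))).congr_deriv ?_
      try simp only [Pi.mul_apply, Pi.add_apply, Pi.sub_apply]
      field_simp
      ring
    have hT2 := hT.const_mul (l * (k₁ + k₃) / k₃)⁻¹
    simp only [intervalIntegral.integral_const_mul] at hT2
    rw [mul_zero] at hT2
    refine S2.of_sq (g := fun n x => (x * (d - x)) ^ 2 * p1 n x ^ 2) h (fun n => cw.mul (e1 n)) (hT2.congr fun n => ?_) fun n x _ => ?_
    · rw [inv_mul_cancel_left₀ (by positivity)]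
    · ring
  have s1t : S2 0 d (fun n x => (x * (d - x)) ^ 2 * p1 n x) :=
    (s1.mulf h cw).congr h (fun n => ct.mul (e1 n)) fun n x _ => by ring
  have zp1 : ZS 0 d (fun n x => (x * (d - x)) ^ 2 * p1 n x ^ 2) :=
    (s1.mulB h s1.toB2).congr h fun n x _ => by ring
  -- then `lam * v1`
  have sy1 : S2 0 d (fun n x => (x * (d - x)) * (lam n * v1 n x)) := by
    have hT : Tendsto (fun n => ∫ x in (0 : ℝ)..d, -(ρ₁ / k₁) *
        ((x * (d - x)) ^ 2 * (lam n * v1 n x) ^ 2)) atTop (nhds 0) := by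
      have hZ := ((((((((R.sv1.mulB h R.bp1).mulf h ct').add h zp1).add h
        (((R.sv1.mulB h R.bp3).mulf h ct).smul (-1))).add h
        (((R.sv1.mulB h R.bp5).mulf h ct).smul (-(l * (k₁ + k₃)) / k₁))).add h
        (((R.sv1.mulB h R.sv1.toB2).mulf h ct).smul (l ^ 2 * k₃ / k₁))).add h
        (((R.sv1.mulB h R.sg1.toB2).mulf h ct).smul (1 / k₁))))
      refine ftc_tendsto h (H := fun n x => (x * (d - x)) ^ 2 * (p1 n x * v1 n x))
        (fun n => ct.mul ((e1 n).mul (c1 n))) (fun n => by simp) (fun n => by simp)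
        (fun n => continuousOn_const.mul (ct.mul ((continuousOn_const.mul (c1 n)).pow 2)))
        hZ fun n x hx => ?_
      refine ((dt x).mul ((R.dp1 n x hx).mul (R.dv1 n x hx))).congr_deriv ?_
      try simp only [Pi.mul_apply, Pi.add_apply, Pi.sub_apply]
      field_simp
      ring
    have hT2 := hT.const_mul (-(ρ₁ / k₁))⁻¹
    simp only [intervalIntegral.integral_const_mul] at hT2
    rw [mul_zero] at hT2
    refine S2.of_sq (g := fun n x => (x * (d - x)) ^ 2 * (lam n * v1 n x) ^ 2) h (fun n => cw.mul (continuousOn_const.mul (c1 n)))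
      (hT2.congr fun n => ?_) fun n x _ => ?_
    · rw [inv_mul_cancel_left₀ (neg_ne_zero.2 (by positivity))]
    · ring
  -- Step 4
  set X : ℕ → ℝ := fun n => ∫ x in (0 : ℝ)..d, (x * (d - x)) ^ 2 *
    (lam n ^ 2 * (p1 n x * v3 n x)) with hX
  set Y : ℕ → ℝ := fun n => ∫ x in (0 : ℝ)..d, (x * (d - x)) ^ 2 * (lam n * v3 n x) ^ 2 with hY
  set W : ℕ → ℝ := fun n => ∫ x in (0 : ℝ)..d, (x * (d - x)) ^ 2 * p3 n x ^ 2 with hW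
  have cX : ∀ n, ContinuousOn (fun x => (x * (d - x)) ^ 2 * (lam n ^ 2 * (p1 n x * v3 n x)))
      (Icc 0 d) := fun n => ct.mul (continuousOn_const.mul ((e1 n).mul (c3 n)))
  have cY : ∀ n, ContinuousOn (fun x => (x * (d - x)) ^ 2 * (lam n * v3 n x) ^ 2) (Icc 0 d) :=
    fun n => ct.mul ((continuousOn_const.mul (c3 n)).pow 2)
  have cW : ∀ n, ContinuousOn (fun x => (x * (d - x)) ^ 2 * p3 n x ^ 2) (Icc 0 d) :=
    fun n => ct.mul ((e3 n).pow 2)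
  have hA : Tendsto (fun n => l * (k₁ + k₃) / k₃ * X n + l * k₁ / k₃ * Y n) atTop (nhds 0) := by
    have hT : Tendsto (fun n => ∫ x in (0 : ℝ)..d,
        (l * (k₁ + k₃) / k₃ * ((x * (d - x)) ^ 2 * (lam n ^ 2 * (p1 n x * v3 n x)))
        + l * k₁ / k₃ * ((x * (d - x)) ^ 2 * (lam n * v3 n x) ^ 2))) atTop (nhds 0) := by
      have hZ := ((((((((((hz.mulB h R.by3).mulf h ct).smul (-ρ₁ / k₃ + ρ₂ / k₂)).add h
        (((sy5.mulB h R.by3).mulf h ct).smul (l ^ 2 * k₁ / k₃ - k₁ / k₂))).add h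
        (((R.slg3.mulB h R.by3).mulf h ct).smul (1 / k₃))).add h
        (((bl2.mulB h R.sv3.toB2).mulf h ct'').smul (-1))).add h
        (((bl2.mulB h R.bp3).mulf h ct').smul (-2))).add h
        (((bl2.mulB h R.bp1).mulf h ct).smul (-k₁ / k₂))).add h
        (((bl2.mulB h R.sv5.toB2).mulf h ct).smul (-k₁ * l / k₂))).add h
        (((bl2.mulB h R.sg2.toB2).mulf h ct).smul (-1 / k₂)))
      refine ftc_tendsto h (H := fun n x => lam n ^ 2 * ((x * (d - x)) ^ 2 * (p5 n x * v3 n x)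
        - (2 * (x * (d - x)) * (d - 2 * x) * (v3 n x * v5 n x)
          + (x * (d - x)) ^ 2 * (p3 n x * v5 n x))))
        (fun n => continuousOn_const.mul ((ct.mul ((e5 n).mul (c3 n))).sub
          ((ct'.mul ((c3 n).mul (c5 n))).add (ct.mul ((e3 n).mul (c5 n))))))
        (fun n => by simp) (fun n => by simp)
        (fun n => (continuousOn_const.mul (cX n)).add (continuousOn_const.mul (cY n)))
        hZ fun n x hx => ?_
      refine ((((dt x).mul ((R.dp5 n x hx).mul (R.dv3 n x hx))).sub
        (((dt' x).mul ((R.dv3 n x hx).mul (R.dv5 n x hx))).add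
        ((dt x).mul ((R.dp3 n x hx).mul (R.dv5 n x hx))))).const_mul
          (lam n ^ 2)).congr_deriv ?_
      try simp only [Pi.mul_apply, Pi.add_apply, Pi.sub_apply]
      field_simp
      ring
    refine hT.congr fun n => ?_
    exact int_lin h (cX n) (cY n) _ _
  have hB : Tendsto (fun n => -k₁ * W n + (ρ₁ - k₁ * ρ₂ / k₂) * X n) atTop (nhds 0) := by
    have hT : Tendsto (fun n => ∫ x in (0 : ℝ)..d,
        (-k₁ * ((x * (d - x)) ^ 2 * p3 n x ^ 2)
        + (ρ₁ - k₁ * ρ₂ / k₂) * ((x * (d - x)) ^ 2 * (lam n ^ 2 * (p1 n x * v3 n x)))))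
        atTop (nhds 0) := by
      have hZ := ((((((((((s1.mulB h R.bp3).mulf h cw').smul (2 * k₁)).add h
        (((sy1.mulB h R.by3).mulf h cw').smul (2 * ρ₁))).add h
        ((s5t.mulB h R.bp3).smul (-(l * (k₁ + k₃))))).add h
        (((R.sv1.mulB h R.bp3).mulf h ct).smul (l ^ 2 * k₃))).add h
        (((R.sg1.mulB h R.bp3).mulf h ct))).add h
        (zp1.smul (k₁ ^ 2 / k₂))).add h
        ((s1t.mulB h R.sv3.toB2).smul (k₁ ^ 2 / k₂))).add h
        ((s1t.mulB h R.sv5.toB2).smul (k₁ ^ 2 * l / k₂))).add h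
        ((s1t.mulB h R.sg2.toB2).smul (k₁ / k₂))
      refine ftc_tendsto h (H := fun n x => (x * (d - x)) ^ 2 * (k₁ * (p1 n x * p3 n x)
        + ρ₁ * lam n ^ 2 * (v1 n x * v3 n x)))
        (fun n => ct.mul ((continuousOn_const.mul ((e1 n).mul (e3 n))).add
          (continuousOn_const.mul ((c1 n).mul (c3 n)))))
        (fun n => by simp) (fun n => by simp)
        (fun n => (continuousOn_const.mul (cW n)).add (continuousOn_const.mul (cX n)))
        hZ fun n x hx => ?_
      refine ((dt x).mul ((((R.dp1 n x hx).mul (R.dp3 n x hx)).const_mul k₁).add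
        (((R.dv1 n x hx).mul (R.dv3 n x hx)).const_mul (ρ₁ * lam n ^ 2)))).congr_deriv ?_
      try simp only [Pi.mul_apply, Pi.add_apply, Pi.sub_apply]
      field_simp
      ring
    refine hT.congr fun n => ?_
    exact int_lin h (cW n) (cX n) _ _
  have hC : Tendsto (fun n => 1 * W n + (-(ρ₂ / k₂)) * Y n) atTop (nhds 0) := by
    have hT : Tendsto (fun n => ∫ x in (0 : ℝ)..d,
        (1 * ((x * (d - x)) ^ 2 * p3 n x ^ 2)
        + (-(ρ₂ / k₂)) * ((x * (d - x)) ^ 2 * (lam n * v3 n x) ^ 2))) atTop (nhds 0) := by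
      have hZ := ((((((R.sv3.mulB h R.bp3).mulf h ct').add h
        (((R.sv3.mulB h R.bp1).mulf h ct).smul (k₁ / k₂))).add h
        (((R.sv3.mulB h R.sv3.toB2).mulf h ct).smul (k₁ / k₂))).add h
        (((R.sv3.mulB h R.sv5.toB2).mulf h ct).smul (k₁ * l / k₂))).add h
        (((R.sv3.mulB h R.sg2.toB2).mulf h ct).smul (1 / k₂)))
      refine ftc_tendsto h (H := fun n x => (x * (d - x)) ^ 2 * (p3 n x * v3 n x))
        (fun n => ct.mul ((e3 n).mul (c3 n))) (fun n => by simp) (fun n => by simp)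
        (fun n => (continuousOn_const.mul (cW n)).add (continuousOn_const.mul (cY n)))
        hZ fun n x hx => ?_
      refine ((dt x).mul ((R.dp3 n x hx).mul (R.dv3 n x hx))).congr_deriv ?_
      try simp only [Pi.mul_apply, Pi.add_apply, Pi.sub_apply]
      field_simp
      ring
    refine hT.congr fun n => ?_
    exact int_lin h (cW n) (cY n) _ _
  have hY0 : Tendsto Y atTop (nhds 0) := by
    have hdet : 0 < k₁ * (ρ₂ * k₃ / k₂ + ρ₁) / (k₁ + k₃) := by positivity
    have hlin := ((hA.const_mul ((ρ₁ - k₁ * ρ₂ / k₂) * k₃ / (l * (k₁ + k₃)))).sub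
      (hB.add (hC.const_mul k₁))).const_mul (k₁ * (ρ₂ * k₃ / k₂ + ρ₁) / (k₁ + k₃))⁻¹
    simp only [mul_zero, add_zero, sub_zero] at hlin
    refine hlin.congr fun n => ?_
    field_simp
    ring
  have hW0 : Tendsto W atTop (nhds 0) := by
    have hlin := hC.add (hY0.const_mul (ρ₂ / k₂))
    simp only [mul_zero, add_zero] at hlin
    refine hlin.congr fun n => ?_
    ring
  -- conclusion
  have sy3 : S2 0 d (fun n x => (x * (d - x)) * (lam n * v3 n x)) :=
    S2.of_sq h (fun n => cw.mul (continuousOn_const.mul (c3 n))) hY0 fun n x _ => by ring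
  have s3 : S2 0 d (fun n x => (x * (d - x)) * p3 n x) :=
    S2.of_sq h (fun n => cw.mul (e3 n)) hW0 fun n x _ => by ring
  have hfin := (((((sy1.mulB h sy1.toB2).smul ρ₁).add h ((s1.mulB h s1.toB2).smul k₁)).add h
    ((sy3.mulB h sy3.toB2).smul ρ₂)).add h ((s3.mulB h s3.toB2).smul k₂)).add h
    ((s5.mulB h s5.toB2).smul k₃) |>.add h (((sy5.mulB h sy5.toB2).mulf h ct).smul ρ₁)
  refine ZS.tendsto h (hfin.congr h fun n x _ => ?_)
  unfold EN
  ring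

end Red

/-- Combining the damped interval with the undamped one. -/
lemma Red.global {ρ₁ ρ₂ k₁ k₂ k₃ l β L : ℝ} {lam : ℕ → ℝ}
    {v1 v3 v5 p1 p3 p5 g1 g2 g3 h1 h2 h3 : ℕ → ℝ → ℝ}
    (R : Red ρ₁ ρ₂ k₁ k₂ k₃ l 0 β lam v1 v3 v5 p1 p3 p5 g1 g2 g3)
    (R' : Red ρ₁ ρ₂ k₁ k₂ k₃ l β L lam v1 v3 v5 p1 p3 p5 h1 h2 h3)
    (hβ : 0 < β) (hr1 : 0 < ρ₁) (hr2 : 0 < ρ₂)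
    (hk1 : 0 < k₁) (hk2 : 0 < k₂) (hk3 : 0 < k₃) (hl : 0 < l)
    (hz : S2 0 β (fun n x => lam n ^ 3 * v5 n x)) :
    ∃ δ : ℕ → ℝ, Tendsto δ atTop (nhds 0) ∧ ∀ n, ∀ x ∈ Icc 0 L,
      Red.EN ρ₁ ρ₂ k₁ k₂ k₃ lam v1 v3 v5 p1 p3 p5 n x ≤ δ n := by
  obtain ⟨δ, hδ, hE⟩ := R.osc hk1 hk2 hk3
  obtain ⟨η, hη, hE'⟩ := R'.osc hk1 hk2 hk3
  have hI := R.local_small hr1 hr2 hk1 hk2 hk3 hl hz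
  set K : ℝ := ∫ x in (0 : ℝ)..β, (x * (β - x)) ^ 2 with hK
  have ct : ContinuousOn (fun x : ℝ => (x * (β - x)) ^ 2) (Icc 0 β) := by fun_prop
  have hKpos : 0 < K := by
    refine intervalIntegral.intervalIntegral_pos_of_pos_on (cint hβ.le ct) (fun x hx => ?_) hβ
    have := mul_pos hx.1 (sub_pos.2 hx.2)
    positivity
  have h1 : ∀ n, ∀ x ∈ Icc 0 β, Red.EN ρ₁ ρ₂ k₁ k₂ k₃ lam v1 v3 v5 p1 p3 p5 n x ≤
      K⁻¹ * (∫ x in (0 : ℝ)..β, (x * (β - x)) ^ 2 *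
        Red.EN ρ₁ ρ₂ k₁ k₂ k₃ lam v1 v3 v5 p1 p3 p5 n x) + δ n := by
    intro n x hx
    have hle : ∫ y in (0 : ℝ)..β, (Red.EN ρ₁ ρ₂ k₁ k₂ k₃ lam v1 v3 v5 p1 p3 p5 n x - δ n) *
        (y * (β - y)) ^ 2 ≤ ∫ x in (0 : ℝ)..β, (x * (β - x)) ^ 2 *
        Red.EN ρ₁ ρ₂ k₁ k₂ k₃ lam v1 v3 v5 p1 p3 p5 n x := by
      refine int_mono hβ.le (continuousOn_const.mul ct) (ct.mul (R.contE n)) fun y hy => ?_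
      rw [mul_comm]
      exact mul_le_mul_of_nonneg_left (by linarith [hE n y hy x hx]) (sq_nonneg _)
    rw [intervalIntegral.integral_const_mul] at hle
    have := mul_le_mul_of_nonneg_left hle (inv_nonneg.2 hKpos.le)
    have e : K⁻¹ * ((Red.EN ρ₁ ρ₂ k₁ k₂ k₃ lam v1 v3 v5 p1 p3 p5 n x - δ n) * K)
      = Red.EN ρ₁ ρ₂ k₁ k₂ k₃ lam v1 v3 v5 p1 p3 p5 n x - δ n := by
      field_simp
    rw [← hK, e] at this
    linarith
  refine ⟨fun n => K⁻¹ * (∫ x in (0 : ℝ)..β, (x * (β - x)) ^ 2 *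
        Red.EN ρ₁ ρ₂ k₁ k₂ k₃ lam v1 v3 v5 p1 p3 p5 n x) + δ n + |η n|, ?_, fun n x hx => ?_⟩
  · simpa using ((hI.const_mul K⁻¹).add hδ).add hη.abs
  · rcases le_total x β with hxb | hxb
    · have := h1 n x ⟨hx.1, hxb⟩
      have := abs_nonneg (η n)
      linarith
    · have := h1 n β ⟨hβ.le, le_rfl⟩
      have := hE' n β ⟨le_rfl, R'.hcd⟩ x ⟨hxb, hx.2⟩
      have := le_abs_self (η n)
      linarith

/-- A Gronwall argument. -/
lemma gronwall_S2 {l L : ℝ} (hL : 0 ≤ L) {f1 f3 f5 d1 d3 d5 : ℕ → ℝ → ℝ}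
    (c1 : ∀ n, ContinuousOn (f1 n) (Icc 0 L)) (c3 : ∀ n, ContinuousOn (f3 n) (Icc 0 L))
    (c5 : ∀ n, ContinuousOn (f5 n) (Icc 0 L))
    (e1 : ∀ n, ContinuousOn (d1 n) (Icc 0 L)) (e3 : ∀ n, ContinuousOn (d3 n) (Icc 0 L))
    (e5 : ∀ n, ContinuousOn (d5 n) (Icc 0 L))
    (h1 : ∀ n, ∀ x ∈ Ioo 0 L, HasDerivAt (f1 n) (d1 n x) x)
    (h3 : ∀ n, ∀ x ∈ Ioo 0 L, HasDerivAt (f3 n) (d3 n x) x)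
    (h5 : ∀ n, ∀ x ∈ Ioo 0 L, HasDerivAt (f5 n) (d5 n x) x)
    (z1 : ∀ n, f1 n 0 = 0) (z3 : ∀ n, f3 n 0 = 0) (z5 : ∀ n, f5 n 0 = 0)
    (s1 : S2 0 L (fun n x => d1 n x + f3 n x + l * f5 n x)) (s3 : S2 0 L d3)
    (s5 : S2 0 L (fun n x => d5 n x - l * f1 n x)) :
    S2 0 L f1 ∧ S2 0 L f3 ∧ S2 0 L f5 := by
  have hZ := ((s1.mulB hL s1.toB2).add hL (s3.mulB hL s3.toB2)).add hL (s5.mulB hL s5.toB2)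
  set D : ℕ → ℝ → ℝ := fun n x => (d1 n x + f3 n x + l * f5 n x) * (d1 n x + f3 n x + l * f5 n x)
    + d3 n x * d3 n x + (d5 n x - l * f1 n x) * (d5 n x - l * f1 n x) with hD
  have hD0 : ∀ n x, 0 ≤ D n x := fun n x => by
    simp only [hD]
    nlinarith [mul_self_nonneg (d1 n x + f3 n x + l * f5 n x), mul_self_nonneg (d3 n x),
      mul_self_nonneg (d5 n x - l * f1 n x)]
  have key : ∀ n, ∀ x ∈ Icc 0 L, f1 n x ^ 2 + f3 n x ^ 2 + f5 n x ^ 2 ≤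
      Real.exp (2 * L) * ∫ x in (0 : ℝ)..L, |D n x| := by
    intro n x hx
    set m : ℝ → ℝ := fun y => Real.exp (-2 * y) * (2 * (f1 n y * d1 n y + f3 n y * d3 n y
      + f5 n y * d5 n y) - 2 * (f1 n y ^ 2 + f3 n y ^ 2 + f5 n y ^ 2)) with hm
    have hc1 := c1 n
    have hc3 := c3 n
    have hc5 := c5 n
    have he1 := e1 n
    have he3 := e3 n
    have he5 := e5 n
    have hsub : Icc 0 x ⊆ Icc 0 L := Icc_subset_Icc le_rfl hx.2
    have mc : ContinuousOn m (Icc 0 L) := by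
      simp only [hm]
      fun_prop
    have Mc : ContinuousOn (fun y => Real.exp (-2 * y) * (f1 n y ^ 2 + f3 n y ^ 2 + f5 n y ^ 2))
        (Icc 0 L) := by
      fun_prop
    have e := intervalIntegral.integral_eq_sub_of_hasDerivAt_of_le hx.1 (Mc.mono hsub)
      (f' := m) (fun y hy => by
        have hy' : y ∈ Ioo 0 L := ⟨hy.1, hy.2.trans_le hx.2⟩
        have he : HasDerivAt (fun y : ℝ => Real.exp (-2 * y)) (Real.exp (-2 * y) * (-2)) y := by
          have := ((hasDerivAt_id y).const_mul (-2)).exp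
          simpa using this
        have := he.mul ((((h1 n y hy').pow 2).add ((h3 n y hy').pow 2)).add ((h5 n y hy').pow 2))
        refine this.congr_deriv ?_
        simp only [hm, Pi.add_apply, Pi.pow_apply]
        push_cast
        ring) (cint hx.1 (mc.mono hsub))
    have hle : ∫ y in (0 : ℝ)..x, m y ≤ ∫ y in (0 : ℝ)..x, |D n y| := by
      refine int_mono hx.1 (mc.mono hsub) ((hZ.1 n).mono hsub).abs fun y hy => ?_
      have hexp : Real.exp (-2 * y) ≤ 1 := Real.exp_le_one_iff.2 (by linarith [hy.1])
      have hpos := Real.exp_pos (-2 * y)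
      have hb : 2 * (f1 n y * d1 n y + f3 n y * d3 n y
        + f5 n y * d5 n y) - 2 * (f1 n y ^ 2 + f3 n y ^ 2 + f5 n y ^ 2) ≤ D n y := by
        simp only [hD]
        nlinarith [sq_nonneg (f1 n y - (d1 n y + f3 n y + l * f5 n y)),
          sq_nonneg (f1 n y + f3 n y), sq_nonneg (f3 n y - d3 n y),
          sq_nonneg (f5 n y - (d5 n y - l * f1 n y)), sq_nonneg (f5 n y)]
      rw [abs_of_nonneg (hD0 n y)]
      simp only [hm]
      refine (mul_le_mul_of_nonneg_left hb hpos.le).trans ?_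
      exact mul_le_of_le_one_left (hD0 n y) hexp
    have hle2 : ∫ y in (0 : ℝ)..x, |D n y| ≤ ∫ y in (0 : ℝ)..L, |D n y| :=
      intervalIntegral.integral_mono_interval le_rfl hx.1 hx.2
        (Eventually.of_forall fun x => abs_nonneg _) (cint hL (hZ.1 n).abs)
    rw [z1, z3, z5] at e
    simp only [ne_eq, OfNat.ofNat_ne_zero, not_false_eq_true, zero_pow, add_zero, mul_zero,
      sub_zero] at e
    have hfin : Real.exp (-2 * x) * (f1 n x ^ 2 + f3 n x ^ 2 + f5 n x ^ 2) ≤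
      ∫ y in (0 : ℝ)..L, |D n y| := by linarith
    have h2 : Real.exp (2 * x) * Real.exp (-2 * x) = 1 := by
      rw [← Real.exp_add]; simp
    calc f1 n x ^ 2 + f3 n x ^ 2 + f5 n x ^ 2
        = Real.exp (2 * x) * (Real.exp (-2 * x) * (f1 n x ^ 2 + f3 n x ^ 2 + f5 n x ^ 2)) := by
          rw [← mul_assoc, h2, one_mul]
      _ ≤ Real.exp (2 * L) * ∫ y in (0 : ℝ)..L, |D n y| := by
          refine mul_le_mul (Real.exp_le_exp.2 (by linarith [hx.2])) hfin ?_ (Real.exp_pos _).le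
          positivity
  have fin : ∀ f : ℕ → ℝ → ℝ, (∀ n, ContinuousOn (f n) (Icc 0 L)) →
      (∀ n x, f n x ^ 2 ≤ f1 n x ^ 2 + f3 n x ^ 2 + f5 n x ^ 2) → S2 0 L f := by
    intro f hf hle
    refine ⟨hf, squeeze_zero (g := fun n => L * (Real.exp (2 * L) * ∫ x in (0 : ℝ)..L, |D n x|))
      (fun n => int_nonneg hL fun x _ => sq_nonneg _) (fun n => ?_) ?_⟩
    · have := int_mono hL (f := fun x => ‖f n x‖ ^ 2) ((hf n).norm.pow 2) (g := fun _ =>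
        Real.exp (2 * L) * ∫ x in (0 : ℝ)..L, |D n x|) continuousOn_const fun x hx => by
          rw [Real.norm_eq_abs, sq_abs]
          exact (hle n x).trans (key n x hx)
      rw [intervalIntegral.integral_const, sub_zero, smul_eq_mul] at this
      exact this
    · simpa using (hZ.2.const_mul (Real.exp (2 * L))).const_mul L
  refine ⟨fin f1 c1 fun n x => ?_, fin f3 c3 fun n x => ?_, fin f5 c5 fun n x => ?_⟩ <;>
  nlinarith [sq_nonneg (f1 n x), sq_nonneg (f3 n x), sq_nonneg (f5 n x)]

lemma S2.re {c d : ℝ} (h : c ≤ d) {f : ℕ → ℝ → ℂ} (hf : S2 c d f) :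
    S2 c d (fun n x => (f n x).re) :=
  hf.of_le h (fun n => Complex.continuous_re.comp_continuousOn (hf.1 n)) 1 fun n x _ => by
    rw [one_mul, Real.norm_eq_abs]; exact Complex.abs_re_le_norm _

lemma S2.im {c d : ℝ} (h : c ≤ d) {f : ℕ → ℝ → ℂ} (hf : S2 c d f) :
    S2 c d (fun n x => (f n x).im) :=
  hf.of_le h (fun n => Complex.continuous_im.comp_continuousOn (hf.1 n)) 1 fun n x _ => by
    rw [one_mul, Real.norm_eq_abs]; exact Complex.abs_im_le_norm _

lemma B2.re {c d : ℝ} (h : c ≤ d) {f : ℕ → ℝ → ℂ} (hf : B2 c d f) :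
    B2 c d (fun n x => (f n x).re) :=
  hf.of_le h (fun n => Complex.continuous_re.comp_continuousOn (hf.1 n)) 1 fun n x _ => by
    rw [one_mul, Real.norm_eq_abs]; exact Complex.abs_re_le_norm _

lemma B2.im {c d : ℝ} (h : c ≤ d) {f : ℕ → ℝ → ℂ} (hf : B2 c d f) :
    B2 c d (fun n x => (f n x).im) :=
  hf.of_le h (fun n => Complex.continuous_im.comp_continuousOn (hf.1 n)) 1 fun n x _ => by
    rw [one_mul, Real.norm_eq_abs]; exact Complex.abs_im_le_norm _

lemma nsq_eq (z : ℂ) : ‖z‖ ^ 2 = z.re ^ 2 + z.im ^ 2 := by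
  rw [← Complex.normSq_eq_norm_sq, Complex.normSq_apply]; ring

lemma S2.of_re_im {c d : ℝ} (h : c ≤ d) {f : ℕ → ℝ → ℂ}
    (hc : ∀ n, ContinuousOn (f n) (Icc c d))
    (h1 : S2 c d (fun n x => (f n x).re)) (h2 : S2 c d (fun n x => (f n x).im)) :
    S2 c d f := by
  refine ⟨hc, ?_⟩
  have := h1.2.add h2.2
  rw [add_zero] at this
  refine this.congr fun n => ?_
  have i1 : IntervalIntegrable (fun x => ‖(f n x).re‖ ^ 2) volume c d :=
    cint h ((h1.1 n).norm.pow 2)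
  have i2 : IntervalIntegrable (fun x => ‖(f n x).im‖ ^ 2) volume c d :=
    cint h ((h2.1 n).norm.pow 2)
  rw [← intervalIntegral.integral_add i1 i2]
  refine intervalIntegral.integral_congr fun x _ => ?_
  simp only [nsq_eq, Real.norm_eq_abs, sq_abs]

lemma S2.innerB {c d : ℝ} (h : c ≤ d) {f g : ℕ → ℝ → ℂ} (hf : S2 c d f) (hg : B2 c d g) :
    ZS c d (fun n x => inner ℝ (f n x) (g n x)) :=
  (((hf.re h).mulB h (hg.re h)).add h ((hf.im h).mulB h (hg.im h))).congr h fun n x _ => by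
    rw [Complex.inner]
    simp
    ring

lemma S2.of_dom {c d : ℝ} (h : c ≤ d) {f : ℕ → ℝ → ℂ} {G : ℕ → ℝ → ℝ} {k : ℝ} (hk : 0 < k)
    (hf : ∀ n, ContinuousOn (f n) (Icc c d)) (hG : ∀ n, ContinuousOn (G n) (Icc c d))
    (ht : Tendsto (fun n => ∫ x in c..d, G n x) atTop (nhds 0))
    (hle : ∀ n x, k * ‖f n x‖ ^ 2 ≤ G n x) : S2 c d f := by
  refine ⟨hf, squeeze_zero (fun n => int_nonneg h fun x _ => sq_nonneg _) (fun n => ?_)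
    (by simpa using ht.const_mul k⁻¹)⟩
  rw [← intervalIntegral.integral_const_mul]
  refine int_mono h ((hf n).norm.pow 2) (continuousOn_const.mul (hG n)) fun x _ => ?_
  rw [le_inv_mul_iff₀ hk]
  exact hle n x

lemma B2.of_dom {c d : ℝ} (h : c ≤ d) {f : ℕ → ℝ → ℂ} {G : ℕ → ℝ → ℝ} {k C : ℝ} (hk : 0 < k)
    (hf : ∀ n, ContinuousOn (f n) (Icc c d)) (hG : ∀ n, ContinuousOn (G n) (Icc c d))
    (ht : ∀ n, ∫ x in c..d, G n x ≤ C)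
    (hle : ∀ n x, k * ‖f n x‖ ^ 2 ≤ G n x) : B2 c d f := by
  refine ⟨hf, k⁻¹ * C, fun n => le_trans ?_ (mul_le_mul_of_nonneg_left (ht n)
    (inv_nonneg.2 hk.le))⟩
  rw [← intervalIntegral.integral_const_mul]
  refine int_mono h ((hf n).norm.pow 2) (continuousOn_const.mul (hG n)) fun x _ => ?_
  rw [le_inv_mul_iff₀ hk]
  exact hle n x

lemma uniq {L : ℝ} (hL : 0 < L) : UniqueDiffOn ℝ (Icc 0 L) := uniqueDiffOn_Icc hL

lemma cD {L : ℝ} (hL : 0 < L) {f : ℝ → ℂ} (hf : ContDiffOn ℝ 1 f (Icc 0 L)) :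
    ContinuousOn (derivWithin f (Icc 0 L)) (Icc 0 L) :=
  hf.continuousOn_derivWithin (uniq hL) le_rfl

lemma hD {L : ℝ} {f : ℝ → ℂ} (hf : ContDiffOn ℝ 1 f (Icc 0 L)) {x : ℝ}
    (hx : x ∈ Ioo 0 L) : HasDerivAt f (derivWithin f (Icc 0 L) x) x :=
  ((hf.differentiableOn (by simp)) x (Ioo_subset_Icc_self hx)).hasDerivWithinAt.hasDerivAt
    (Icc_mem_nhds hx.1 hx.2)

lemma hD_eq {L : ℝ} {f : ℝ → ℂ} (hf : ContDiffOn ℝ 1 f (Icc 0 L)) {x : ℝ}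
    (hx : x ∈ Ioo 0 L) : deriv f x = derivWithin f (Icc 0 L) x := (hD hf hx).deriv

lemma hDD {L c d : ℝ} {f : ℝ → ℂ} (hf : ContDiffOn ℝ 2 f (Icc c d)) {x : ℝ}
    (h0 : 0 ≤ c) (hdL : d ≤ L)
    (hx : x ∈ Ioo c d) : HasDerivAt (derivWithin f (Icc 0 L)) (deriv (deriv f) x) x := by
  have h1 : ContDiffOn ℝ 1 (deriv f) (Ioo c d) :=
    ((contDiffOn_succ_iff_deriv_of_isOpen (n := 1) isOpen_Ioo).1
      (hf.mono Ioo_subset_Icc_self)).2.2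
  have h2 : HasDerivAt (deriv f) (deriv (deriv f) x) x :=
    ((h1.differentiableOn (by simp)).differentiableAt (Ioo_mem_nhds hx.1 hx.2)).hasDerivAt
  refine h2.congr_of_eventuallyEq ?_
  filter_upwards [Ioo_mem_nhds hx.1 hx.2] with y hy
  exact derivWithin_of_mem_nhds (Icc_mem_nhds (h0.trans_lt hy.1) (hy.2.trans_le hdL))

section Setting

variable {ρ₁ ρ₂ k₁ k₂ k₃ l L β a₀ : ℝ}

/-- the one-sided derivative on `[0,L]` -/
def DW (L : ℝ) (f : ℕ → ℝ → ℂ) : ℕ → ℝ → ℂ := fun n => derivWithin (f n) (Icc 0 L)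

lemma inv_lam_tendsto {lam : ℕ → ℝ} (h : Tendsto (fun n => |lam n|) atTop atTop) :
    Tendsto (fun n => (lam n)⁻¹) atTop (nhds 0) := by
  have := h.inv_tendsto_atTop
  rw [tendsto_zero_iff_abs_tendsto_zero]
  refine this.congr fun n => ?_
  simp [abs_inv]

/-- the right-hand side is small in all components -/
lemma small_F (hr1 : 0 < ρ₁) (hr2 : 0 < ρ₂) (hk1 : 0 < k₁) (hk2 : 0 < k₂) (hk3 : 0 < k₃)
    (hL : 0 < L) (S : BresseSetting ρ₁ ρ₂ k₁ k₂ k₃ l L β a₀ 4) :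
    S2 0 L S.f2 ∧ S2 0 L S.f4 ∧ S2 0 L S.f6 ∧
    S2 0 L (fun n x => DW L S.f1 n x + S.f3 n x + (l : ℂ) * S.f5 n x) ∧
    S2 0 L (DW L S.f3) ∧ S2 0 L (fun n x => DW L S.f5 n x - (l : ℂ) * S.f1 n x) ∧
    S2 0 L S.f1 ∧ S2 0 L S.f3 ∧ S2 0 L S.f5 := by
  have c1 := fun n => (S.reg_f1 n).continuousOn
  have c3 := fun n => (S.reg_f3 n).continuousOn
  have c5 := fun n => (S.reg_f5 n).continuousOn
  have c2 := S.reg_f2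
  have c4 := S.reg_f4
  have c6 := S.reg_f6
  have e1 : ∀ n, ContinuousOn (DW L S.f1 n) (Icc 0 L) := fun n => cD hL (S.reg_f1 n)
  have e3 : ∀ n, ContinuousOn (DW L S.f3 n) (Icc 0 L) := fun n => cD hL (S.reg_f3 n)
  have e5 : ∀ n, ContinuousOn (DW L S.f5 n) (Icc 0 L) := fun n => cD hL (S.reg_f5 n)
  have cP : ∀ n, ContinuousOn (fun x => DW L S.f1 n x + S.f3 n x + (l : ℂ) * S.f5 n x) (Icc 0 L) :=
    fun n => ((e1 n).add (c3 n)).add (continuousOn_const.mul (c5 n))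
  have cQ : ∀ n, ContinuousOn (fun x => DW L S.f5 n x - (l : ℂ) * S.f1 n x) (Icc 0 L) :=
    fun n => (e5 n).sub (continuousOn_const.mul (c1 n))
  set G : ℕ → ℝ → ℝ := fun n x => k₁ * ‖DW L S.f1 n x + S.f3 n x + (l : ℂ) * S.f5 n x‖ ^ 2
    + ρ₁ * ‖S.f2 n x‖ ^ 2 + k₂ * ‖DW L S.f3 n x‖ ^ 2 + ρ₂ * ‖S.f4 n x‖ ^ 2
    + k₃ * ‖DW L S.f5 n x - (l : ℂ) * S.f1 n x‖ ^ 2 + ρ₁ * ‖S.f6 n x‖ ^ 2 with hG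
  have cG : ∀ n, ContinuousOn (G n) (Icc 0 L) := fun n =>
    (((((continuousOn_const.mul ((cP n).norm.pow 2)).add
      (continuousOn_const.mul ((c2 n).norm.pow 2))).add
      (continuousOn_const.mul ((e3 n).norm.pow 2))).add
      (continuousOn_const.mul ((c4 n).norm.pow 2))).add
      (continuousOn_const.mul ((cQ n).norm.pow 2))).add
      (continuousOn_const.mul ((c6 n).norm.pow 2))
  have tG : Tendsto (fun n => ∫ x in (0 : ℝ)..L, G n x) atTop (nhds 0) := by
    refine S.normF.congr fun n => ?_
    refine intervalIntegral.integral_congr_Ioo_of_le hL.le fun x hx => ?_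
    simp only [hG, DW]
    rw [hD_eq (S.reg_f1 n) hx, hD_eq (S.reg_f3 n) hx, hD_eq (S.reg_f5 n) hx]
  have p1 : ∀ n x, 0 ≤ k₁ * ‖DW L S.f1 n x + S.f3 n x + (l : ℂ) * S.f5 n x‖ ^ 2 :=
    fun n x => by positivity
  have p2 : ∀ n x, 0 ≤ ρ₁ * ‖S.f2 n x‖ ^ 2 := fun n x => by positivity
  have p3 : ∀ n x, 0 ≤ k₂ * ‖DW L S.f3 n x‖ ^ 2 := fun n x => by positivity
  have p4 : ∀ n x, 0 ≤ ρ₂ * ‖S.f4 n x‖ ^ 2 := fun n x => by positivity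
  have p5 : ∀ n x, 0 ≤ k₃ * ‖DW L S.f5 n x - (l : ℂ) * S.f1 n x‖ ^ 2 := fun n x => by positivity
  have p6 : ∀ n x, 0 ≤ ρ₁ * ‖S.f6 n x‖ ^ 2 := fun n x => by positivity
  have sP : S2 0 L (fun n x => DW L S.f1 n x + S.f3 n x + (l : ℂ) * S.f5 n x) :=
    S2.of_dom hL.le hk1 cP cG tG fun n x => by
      simp only [hG]; linarith [p1 n x, p2 n x, p3 n x, p4 n x, p5 n x, p6 n x]
  have s2 : S2 0 L S.f2 := S2.of_dom hL.le hr1 c2 cG tG fun n x => by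
      simp only [hG]; linarith [p1 n x, p2 n x, p3 n x, p4 n x, p5 n x, p6 n x]
  have s3 : S2 0 L (DW L S.f3) := S2.of_dom hL.le hk2 e3 cG tG fun n x => by
      simp only [hG]; linarith [p1 n x, p2 n x, p3 n x, p4 n x, p5 n x, p6 n x]
  have s4 : S2 0 L S.f4 := S2.of_dom hL.le hr2 c4 cG tG fun n x => by
      simp only [hG]; linarith [p1 n x, p2 n x, p3 n x, p4 n x, p5 n x, p6 n x]
  have sQ : S2 0 L (fun n x => DW L S.f5 n x - (l : ℂ) * S.f1 n x) :=
    S2.of_dom hL.le hk3 cQ cG tG fun n x => by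
      simp only [hG]; linarith [p1 n x, p2 n x, p3 n x, p4 n x, p5 n x, p6 n x]
  have s6 : S2 0 L S.f6 := S2.of_dom hL.le hr1 c6 cG tG fun n x => by
      simp only [hG]; linarith [p1 n x, p2 n x, p3 n x, p4 n x, p5 n x, p6 n x]
  have cre : ∀ {f : ℕ → ℝ → ℂ}, (∀ n, ContinuousOn (f n) (Icc 0 L)) →
      ∀ n, ContinuousOn (fun x => (f n x).re) (Icc 0 L) :=
    fun h n => Complex.continuous_re.comp_continuousOn (h n)
  have cim : ∀ {f : ℕ → ℝ → ℂ}, (∀ n, ContinuousOn (f n) (Icc 0 L)) →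
      ∀ n, ContinuousOn (fun x => (f n x).im) (Icc 0 L) :=
    fun h n => Complex.continuous_im.comp_continuousOn (h n)
  have dre : ∀ {f : ℝ → ℂ} {z : ℂ} {x : ℝ}, HasDerivAt f z x →
      HasDerivAt (fun x => (f x).re) z.re x := fun h =>
    (Complex.reCLM.hasFDerivAt.comp_hasDerivAt _ h)
  have dim : ∀ {f : ℝ → ℂ} {z : ℂ} {x : ℝ}, HasDerivAt f z x →
      HasDerivAt (fun x => (f x).im) z.im x := fun h =>
    (Complex.imCLM.hasFDerivAt.comp_hasDerivAt _ h)
  have z1 : ∀ n, S.f1 n 0 = 0 := fun n => (S.bc_zero n).2.2.2.2.2.2.1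
  have z3 : ∀ n, S.f3 n 0 = 0 := fun n => (S.bc_zero n).2.2.2.2.2.2.2.1
  have z5 : ∀ n, S.f5 n 0 = 0 := fun n => (S.bc_zero n).2.2.2.2.2.2.2.2
  obtain ⟨r1, r3, r5⟩ := gronwall_S2 (l := l) hL.le (cre c1) (cre c3) (cre c5)
    (cre e1) (cre e3) (cre e5)
    (fun n x hx => dre (hD (S.reg_f1 n) hx)) (fun n x hx => dre (hD (S.reg_f3 n) hx))
    (fun n x hx => dre (hD (S.reg_f5 n) hx))
    (fun n => by rw [z1, Complex.zero_re]) (fun n => by rw [z3, Complex.zero_re])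
    (fun n => by rw [z5, Complex.zero_re])
    (by simpa using sP.re hL.le) (s3.re hL.le) (by simpa using sQ.re hL.le)
  obtain ⟨i1, i3, i5⟩ := gronwall_S2 (l := l) hL.le (cim c1) (cim c3) (cim c5)
    (cim e1) (cim e3) (cim e5)
    (fun n x hx => dim (hD (S.reg_f1 n) hx)) (fun n x hx => dim (hD (S.reg_f3 n) hx))
    (fun n x hx => dim (hD (S.reg_f5 n) hx))
    (fun n => by rw [z1, Complex.zero_im]) (fun n => by rw [z3, Complex.zero_im])
    (fun n => by rw [z5, Complex.zero_im])
    (by simpa using sP.im hL.le) (s3.im hL.le) (by simpa using sQ.im hL.le)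
  exact ⟨s2, s4, s6, sP, s3, sQ, S2.of_re_im hL.le c1 r1 i1, S2.of_re_im hL.le c3 r3 i3,
    S2.of_re_im hL.le c5 r5 i5⟩

/-- the energy components are bounded -/
lemma bdd_U (hr1 : 0 < ρ₁) (hr2 : 0 < ρ₂) (hk1 : 0 < k₁) (hk2 : 0 < k₂) (hk3 : 0 < k₃)
    (hL : 0 < L) (S : BresseSetting ρ₁ ρ₂ k₁ k₂ k₃ l L β a₀ 4) :
    B2 0 L S.v2 ∧ B2 0 L S.v4 ∧ B2 0 L S.v6 ∧
    B2 0 L (fun n x => DW L S.v1 n x + S.v3 n x + (l : ℂ) * S.v5 n x) ∧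
    B2 0 L (DW L S.v3) ∧ B2 0 L (fun n x => DW L S.v5 n x - (l : ℂ) * S.v1 n x) := by
  have c1 := fun n => (S.reg_v1 n).continuousOn
  have c3 := fun n => (S.reg_v3 n).continuousOn
  have c5 := fun n => (S.reg_v5 n).continuousOn
  have c2 := fun n => (S.reg_v2 n).continuousOn
  have c4 := fun n => (S.reg_v4 n).continuousOn
  have c6 := fun n => (S.reg_v6 n).continuousOn
  have q1 : ∀ n, ContDiffOn ℝ 1 (S.v1 n) (Icc 0 L) := fun n => (S.reg_v1 n).of_le one_le_two
  have q3 : ∀ n, ContDiffOn ℝ 1 (S.v3 n) (Icc 0 L) := fun n => (S.reg_v3 n).of_le one_le_two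
  have e1 : ∀ n, ContinuousOn (DW L S.v1 n) (Icc 0 L) := fun n => cD hL (q1 n)
  have e3 : ∀ n, ContinuousOn (DW L S.v3 n) (Icc 0 L) := fun n => cD hL (q3 n)
  have e5 : ∀ n, ContinuousOn (DW L S.v5 n) (Icc 0 L) := fun n => cD hL (S.reg_v5 n)
  have cP : ∀ n, ContinuousOn (fun x => DW L S.v1 n x + S.v3 n x + (l : ℂ) * S.v5 n x) (Icc 0 L) :=
    fun n => ((e1 n).add (c3 n)).add (continuousOn_const.mul (c5 n))
  have cQ : ∀ n, ContinuousOn (fun x => DW L S.v5 n x - (l : ℂ) * S.v1 n x) (Icc 0 L) :=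
    fun n => (e5 n).sub (continuousOn_const.mul (c1 n))
  set G : ℕ → ℝ → ℝ := fun n x => k₁ * ‖DW L S.v1 n x + S.v3 n x + (l : ℂ) * S.v5 n x‖ ^ 2
    + ρ₁ * ‖S.v2 n x‖ ^ 2 + k₂ * ‖DW L S.v3 n x‖ ^ 2 + ρ₂ * ‖S.v4 n x‖ ^ 2
    + k₃ * ‖DW L S.v5 n x - (l : ℂ) * S.v1 n x‖ ^ 2 + ρ₁ * ‖S.v6 n x‖ ^ 2 with hG
  have cG : ∀ n, ContinuousOn (G n) (Icc 0 L) := fun n =>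
    (((((continuousOn_const.mul ((cP n).norm.pow 2)).add
      (continuousOn_const.mul ((c2 n).norm.pow 2))).add
      (continuousOn_const.mul ((e3 n).norm.pow 2))).add
      (continuousOn_const.mul ((c4 n).norm.pow 2))).add
      (continuousOn_const.mul ((cQ n).norm.pow 2))).add
      (continuousOn_const.mul ((c6 n).norm.pow 2))
  have tG : ∀ n, ∫ x in (0 : ℝ)..L, G n x ≤ 1 := by
    intro n
    rw [← S.normU n]
    refine le_of_eq (intervalIntegral.integral_congr_Ioo_of_le hL.le fun x hx => ?_)
    simp only [hG, DW]
    rw [hD_eq (q1 n) hx, hD_eq (q3 n) hx, hD_eq (S.reg_v5 n) hx]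
  have p1 : ∀ n x, 0 ≤ k₁ * ‖DW L S.v1 n x + S.v3 n x + (l : ℂ) * S.v5 n x‖ ^ 2 :=
    fun n x => by positivity
  have p2 : ∀ n x, 0 ≤ ρ₁ * ‖S.v2 n x‖ ^ 2 := fun n x => by positivity
  have p3 : ∀ n x, 0 ≤ k₂ * ‖DW L S.v3 n x‖ ^ 2 := fun n x => by positivity
  have p4 : ∀ n x, 0 ≤ ρ₂ * ‖S.v4 n x‖ ^ 2 := fun n x => by positivity
  have p5 : ∀ n x, 0 ≤ k₃ * ‖DW L S.v5 n x - (l : ℂ) * S.v1 n x‖ ^ 2 := fun n x => by positivity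
  have p6 : ∀ n x, 0 ≤ ρ₁ * ‖S.v6 n x‖ ^ 2 := fun n x => by positivity
  refine ⟨B2.of_dom hL.le hr1 c2 cG tG fun n x => ?_, B2.of_dom hL.le hr2 c4 cG tG fun n x => ?_,
    B2.of_dom hL.le hr1 c6 cG tG fun n x => ?_, B2.of_dom hL.le hk1 cP cG tG fun n x => ?_,
    B2.of_dom hL.le hk2 e3 cG tG fun n x => ?_, B2.of_dom hL.le hk3 cQ cG tG fun n x => ?_⟩ <;>
  · simp only [hG]; linarith [p1 n x, p2 n x, p3 n x, p4 n x, p5 n x, p6 n x]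

lemma diss_alg (ρ₁ ρ₂ k₁ k₂ k₃ l a lam m : ℝ)
    (v1 v2 v3 v4 v5 v6 p1 p3 p5 f1 f2 f3 f4 f5 f6 d1 d3 d5 w1 w3 w5 : ℂ)
    (Q1 : v2 = Complex.I * lam * v1 - m * f1) (Q3 : v4 = Complex.I * lam * v3 - m * f3)
    (Q5 : v6 = Complex.I * lam * v5 - m * f5)
    (E1 : (k₁ : ℂ) * (w1 + p3 + l * p5) = Complex.I * lam * ρ₁ * v2 - l * k₃ * (p5 - l * v1)
      - ρ₁ * m * f2)
    (E3 : (k₂ : ℂ) * w3 = Complex.I * lam * ρ₂ * v4 + k₁ * (p1 + v3 + l * v5) - ρ₂ * m * f4)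
    (E5 : (k₃ : ℂ) * (w5 - l * p1) = Complex.I * lam * ρ₁ * v6 + l * k₁ * (p1 + v3 + l * v5)
      + a * v6 - ρ₁ * m * f6) :
    k₁ * (inner ℝ (p1 + v3 + l * v5) (Complex.I * lam * p1 - m * d1)
        + inner ℝ (w1 + p3 + l * p5) v2)
      + k₂ * (inner ℝ p3 (Complex.I * lam * p3 - m * d3) + inner ℝ w3 v4)
      + k₃ * (inner ℝ (p5 - l * v1) (Complex.I * lam * p5 - m * d5) + inner ℝ (w5 - l * p1) v6)
    = a * ‖v6‖ ^ 2 - m * (ρ₁ * inner ℝ f2 v2 + ρ₂ * inner ℝ f4 v4 + ρ₁ * inner ℝ f6 v6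
      + k₁ * inner ℝ (d1 + f3 + l * f5) (p1 + v3 + l * v5) + k₂ * inner ℝ d3 p3
      + k₃ * inner ℝ (d5 - l * f1) (p5 - l * v1)) := by
  have hr := fun {z w : ℂ} (h : z = w) => congrArg Complex.re h
  have hi := fun {z w : ℂ} (h : z = w) => congrArg Complex.im h
  have a1 := hr Q1
  have a2 := hi Q1
  have a3 := hr Q3
  have a4 := hi Q3
  have a5 := hr Q5
  have a6 := hi Q5
  have b1 := hr E1
  have b2 := hi E1
  have b3 := hr E3
  have b4 := hi E3
  have b5 := hr E5
  have b6 := hi E5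
  rw [nsq_eq]
  simp only [Complex.inner, Complex.add_re, Complex.add_im, Complex.sub_re, Complex.sub_im,
    Complex.mul_re, Complex.mul_im, Complex.conj_re, Complex.conj_im, Complex.I_re, Complex.I_im,
    Complex.ofReal_re, Complex.ofReal_im, zero_mul, one_mul, mul_zero, sub_zero, zero_sub,
    add_zero, zero_add, neg_mul] at *
  linear_combination v2.re * b1 + v2.im * b2 + v4.re * b3 + v4.im * b4 + v6.re * b5 + v6.im * b6
    + k₁ * (p1.re + v3.re + l * v5.re) * (a3 + l * a5)
    + k₁ * (p1.im + v3.im + l * v5.im) * (a4 + l * a6)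
    - l * k₃ * (p5.re - l * v1.re) * a1 - l * k₃ * (p5.im - l * v1.im) * a2

lemma zpow_four (x : ℝ) : (x : ℂ) ^ (-((4 : ℕ) : ℤ)) = ((x⁻¹ ^ 4 : ℝ) : ℂ) := by
  rw [zpow_neg, zpow_natCast]
  push_cast
  rw [inv_pow]

lemma mem_nhds_pieces {x : ℝ} (hx : x ∈ Ioo (0 : ℝ) β ∪ Ioo β L) :
    Ioo (0 : ℝ) β ∪ Ioo β L ∈ nhds x := (isOpen_Ioo.union isOpen_Ioo).mem_nhds hx

lemma pieces_sub (hb : 0 < β) (hbL : β < L) {x : ℝ} (hx : x ∈ Ioo (0 : ℝ) β ∪ Ioo β L) :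
    x ∈ Ioo 0 L := by
  rcases hx with hx | hx
  · exact ⟨hx.1, hx.2.trans hbL⟩
  · exact ⟨hb.trans hx.1, hx.2⟩

/-- pointwise form of the equations -/
lemma eqs (hb : 0 < β) (hbL : β < L) (S : BresseSetting ρ₁ ρ₂ k₁ k₂ k₃ l L β a₀ 4)
    (n : ℕ) {x : ℝ} (hx : x ∈ Ioo (0 : ℝ) β ∪ Ioo β L) :
    ∃ w1 w3 w5 : ℂ, HasDerivAt (DW L S.v1 n) w1 x ∧ HasDerivAt (DW L S.v3 n) w3 x ∧
      HasDerivAt (DW L S.v5 n) w5 x ∧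
      (k₁ : ℂ) * (w1 + DW L S.v3 n x + l * DW L S.v5 n x)
        = Complex.I * S.lam n * ρ₁ * S.v2 n x - l * k₃ * (DW L S.v5 n x - l * S.v1 n x)
          - ρ₁ * (((S.lam n)⁻¹ ^ 4 : ℝ) : ℂ) * S.f2 n x ∧
      (k₂ : ℂ) * w3 = Complex.I * S.lam n * ρ₂ * S.v4 n x
        + k₁ * (DW L S.v1 n x + S.v3 n x + l * S.v5 n x)
          - ρ₂ * (((S.lam n)⁻¹ ^ 4 : ℝ) : ℂ) * S.f4 n x ∧
      (k₃ : ℂ) * (w5 - l * DW L S.v1 n x) = Complex.I * S.lam n * ρ₁ * S.v6 n x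
        + l * k₁ * (DW L S.v1 n x + S.v3 n x + l * S.v5 n x)
        + ((if x < β then a₀ else 0 : ℝ) : ℂ) * S.v6 n x
          - ρ₁ * (((S.lam n)⁻¹ ^ 4 : ℝ) : ℂ) * S.f6 n x := by
  have hxL := pieces_sub hb hbL hx
  have q1 : ContDiffOn ℝ 1 (S.v1 n) (Icc 0 L) := (S.reg_v1 n).of_le one_le_two
  have q3 : ContDiffOn ℝ 1 (S.v3 n) (Icc 0 L) := (S.reg_v3 n).of_le one_le_two
  have q5 := S.reg_v5 n
  have D1 : HasDerivAt (DW L S.v1 n) (deriv (deriv (S.v1 n)) x) x :=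
    hDD (S.reg_v1 n) le_rfl le_rfl hxL
  have D3 : HasDerivAt (DW L S.v3 n) (deriv (deriv (S.v3 n)) x) x :=
    hDD (S.reg_v3 n) le_rfl le_rfl hxL
  have D5 : HasDerivAt (DW L S.v5 n) (deriv (deriv (S.v5 n)) x) x := by
    rcases hx with hx | hx
    · exact hDD (S.reg_v5_left n) le_rfl hbL.le hx
    · exact hDD (S.reg_v5_right n) hb.le le_rfl hx
  have eq : ∀ᶠ y in nhds x, y ∈ Ioo 0 L := Ioo_mem_nhds hxL.1 hxL.2
  have A : deriv (fun y => deriv (S.v1 n) y + S.v3 n y + (l : ℂ) * S.v5 n y) x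
      = deriv (deriv (S.v1 n)) x + DW L S.v3 n x + l * DW L S.v5 n x := by
    have h := (D1.add (hD q3 hxL)).add ((hD q5 hxL).const_mul (l : ℂ))
    refine (h.congr_of_eventuallyEq ?_).deriv
    filter_upwards [eq] with y hy
    simp only [Pi.add_apply]
    rw [hD_eq q1 hy]; rfl
  have B : deriv (fun y => deriv (S.v5 n) y - (l : ℂ) * S.v1 n y) x
      = deriv (deriv (S.v5 n)) x - l * DW L S.v1 n x := by
    have h := D5.sub ((hD q1 hxL).const_mul (l : ℂ))
    refine (h.congr_of_eventuallyEq ?_).deriv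
    filter_upwards [eq] with y hy
    simp only [Pi.sub_apply]
    rw [hD_eq q5 hy]; rfl
  have e2 := S.eq2 n x hx
  have e4 := S.eq4 n x hx
  have e6 := S.eq6 n x hx
  rw [A] at e2
  rw [B] at e6
  rw [zpow_four, hD_eq q5 hxL] at e2
  rw [zpow_four, hD_eq q1 hxL] at e4 e6
  have hif : (if x < β then (a₀ : ℂ) else 0) = ((if x < β then a₀ else 0 : ℝ) : ℂ) := by
    split_ifs <;> simp
  rw [hif] at e6
  refine ⟨_, _, _, D1, D3, D5, ?_, ?_, ?_⟩
  · simp only [DW] at *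
    linear_combination -e2
  · simp only [DW] at *
    linear_combination -e4
  · simp only [DW] at *
    linear_combination -e6

lemma first_eqs (S : BresseSetting ρ₁ ρ₂ k₁ k₂ k₃ l L β a₀ 4)
    (n : ℕ) {x : ℝ} (hx : x ∈ Ioo (0 : ℝ) β ∪ Ioo β L) :
    S.v2 n x = Complex.I * S.lam n * S.v1 n x - (((S.lam n)⁻¹ ^ 4 : ℝ) : ℂ) * S.f1 n x ∧
    S.v4 n x = Complex.I * S.lam n * S.v3 n x - (((S.lam n)⁻¹ ^ 4 : ℝ) : ℂ) * S.f3 n x ∧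
    S.v6 n x = Complex.I * S.lam n * S.v5 n x - (((S.lam n)⁻¹ ^ 4 : ℝ) : ℂ) * S.f5 n x := by
  have e1 := S.eq1 n x hx
  have e3 := S.eq3 n x hx
  have e5 := S.eq5 n x hx
  rw [zpow_four] at e1 e3 e5
  exact ⟨by linear_combination -e1, by linear_combination -e3, by linear_combination -e5⟩

lemma first_derivs (hb : 0 < β) (hbL : β < L) (S : BresseSetting ρ₁ ρ₂ k₁ k₂ k₃ l L β a₀ 4)
    (n : ℕ) {x : ℝ} (hx : x ∈ Ioo (0 : ℝ) β ∪ Ioo β L) :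
    HasDerivAt (S.v2 n) (Complex.I * S.lam n * DW L S.v1 n x
      - (((S.lam n)⁻¹ ^ 4 : ℝ) : ℂ) * DW L S.f1 n x) x ∧
    HasDerivAt (S.v4 n) (Complex.I * S.lam n * DW L S.v3 n x
      - (((S.lam n)⁻¹ ^ 4 : ℝ) : ℂ) * DW L S.f3 n x) x ∧
    HasDerivAt (S.v6 n) (Complex.I * S.lam n * DW L S.v5 n x
      - (((S.lam n)⁻¹ ^ 4 : ℝ) : ℂ) * DW L S.f5 n x) x := by
  have hxL := pieces_sub hb hbL hx
  have hm := mem_nhds_pieces hx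
  refine ⟨?_, ?_, ?_⟩
  · refine (((hD ((S.reg_v1 n).of_le one_le_two) hxL).const_mul (Complex.I * S.lam n)).sub
      ((hD (S.reg_f1 n) hxL).const_mul _)).congr_of_eventuallyEq ?_
    filter_upwards [hm] with y hy using (first_eqs S n hy).1
  · refine (((hD ((S.reg_v3 n).of_le one_le_two) hxL).const_mul (Complex.I * S.lam n)).sub
      ((hD (S.reg_f3 n) hxL).const_mul _)).congr_of_eventuallyEq ?_
    filter_upwards [hm] with y hy using (first_eqs S n hy).2.1
  · refine (((hD (S.reg_v5 n) hxL).const_mul (Complex.I * S.lam n)).sub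
      ((hD (S.reg_f5 n) hxL).const_mul _)).congr_of_eventuallyEq ?_
    filter_upwards [hm] with y hy using (first_eqs S n hy).2.2

/-- smallness of the damped velocity -/
lemma small_v6 (hr1 : 0 < ρ₁) (hr2 : 0 < ρ₂) (hk1 : 0 < k₁) (hk2 : 0 < k₂) (hk3 : 0 < k₃)
    (ha : 0 < a₀) (hb : 0 < β) (hbL : β < L) (S : BresseSetting ρ₁ ρ₂ k₁ k₂ k₃ l L β a₀ 4) :
    S2 0 β (fun n x => S.lam n ^ 2 • S.v6 n x) := by
  have hL : 0 < L := hb.trans hbL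
  obtain ⟨s2, s4, s6, sP, s3, sQ, -, -, -⟩ := small_F hr1 hr2 hk1 hk2 hk3 hL S
  obtain ⟨b2, b4, b6, bP, b3, bQ⟩ := bdd_U hr1 hr2 hk1 hk2 hk3 hL S
  have Z := ((((((s2.innerB hL.le b2).smul ρ₁).add hL.le ((s4.innerB hL.le b4).smul ρ₂)).add hL.le
    ((s6.innerB hL.le b6).smul ρ₁)).add hL.le ((sP.innerB hL.le bP).smul k₁)).add hL.le
    ((s3.innerB hL.le b3).smul k₂)).add hL.le ((sQ.innerB hL.le bQ).smul k₃)
  set r : ℕ → ℝ → ℝ := fun n x => ρ₁ * inner ℝ (S.f2 n x) (S.v2 n x)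
    + ρ₂ * inner ℝ (S.f4 n x) (S.v4 n x) + ρ₁ * inner ℝ (S.f6 n x) (S.v6 n x)
    + k₁ * inner ℝ (DW L S.f1 n x + S.f3 n x + (l : ℂ) * S.f5 n x)
        (DW L S.v1 n x + S.v3 n x + (l : ℂ) * S.v5 n x)
    + k₂ * inner ℝ (DW L S.f3 n x) (DW L S.v3 n x)
    + k₃ * inner ℝ (DW L S.f5 n x - (l : ℂ) * S.f1 n x) (DW L S.v5 n x - (l : ℂ) * S.v1 n x)
    with hr
  have Z' : ZS 0 L r := Z
  set G : ℕ → ℝ → ℝ := fun n x =>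
    k₁ * inner ℝ (DW L S.v1 n x + S.v3 n x + (l : ℂ) * S.v5 n x) (S.v2 n x)
    + k₂ * inner ℝ (DW L S.v3 n x) (S.v4 n x)
    + k₃ * inner ℝ (DW L S.v5 n x - (l : ℂ) * S.v1 n x) (S.v6 n x) with hG
  have cG : ∀ n, ContinuousOn (G n) (Icc 0 L) := fun n =>
    ((continuousOn_const.mul ((bP.1 n).inner (𝕜 := ℝ) (b2.1 n))).add
      (continuousOn_const.mul ((b3.1 n).inner (𝕜 := ℝ) (b4.1 n)))).add
      (continuousOn_const.mul ((bQ.1 n).inner (𝕜 := ℝ) (b6.1 n)))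
  have dG : ∀ n, ∀ x ∈ Ioo (0 : ℝ) β ∪ Ioo β L, HasDerivAt (G n)
      ((if x < β then a₀ else 0) * ‖S.v6 n x‖ ^ 2 - (S.lam n)⁻¹ ^ 4 * r n x) x := by
    intro n x hx
    have hxL := pieces_sub hb hbL hx
    obtain ⟨w1, w3, w5, D1, D3, D5, E1, E3, E5⟩ := eqs hb hbL S n hx
    obtain ⟨Q1, Q3, Q5⟩ := first_eqs S n hx
    obtain ⟨F1, F3, F5⟩ := first_derivs hb hbL S n hx
    have h1 := hD ((S.reg_v1 n).of_le one_le_two) hxL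
    have h3 := hD ((S.reg_v3 n).of_le one_le_two) hxL
    have h5 := hD (S.reg_v5 n) hxL
    have X := (((((D1.add h3).add (h5.const_mul (l : ℂ))).inner ℝ F1).const_mul k₁).add
      ((D3.inner ℝ F3).const_mul k₂)).add
      (((D5.sub (h1.const_mul (l : ℂ))).inner ℝ F5).const_mul k₃)
    refine X.congr_deriv ?_
    exact diss_alg ρ₁ ρ₂ k₁ k₂ k₃ l (if x < β then a₀ else 0) (S.lam n) ((S.lam n)⁻¹ ^ 4)
      _ _ _ _ _ _ _ _ _ _ _ _ _ _ _ _ _ _ _ _ _ Q1 Q3 Q5 E1 E3 E5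
  have i6 : ∀ n, ContinuousOn (fun x => ‖S.v6 n x‖ ^ 2) (Icc 0 L) := fun n => (b6.1 n).norm.pow 2
  have sl : Icc (0 : ℝ) β ⊆ Icc 0 L := Icc_subset_Icc le_rfl hbL.le
  have sr : Icc β L ⊆ Icc 0 L := Icc_subset_Icc hb.le le_rfl
  have main : ∀ n, S.lam n ^ 4 * ∫ x in (0 : ℝ)..β, ‖S.v6 n x‖ ^ 2
      = a₀⁻¹ * ∫ x in (0 : ℝ)..L, r n x := by
    intro n
    have J1 : ∫ x in (0 : ℝ)..β, (a₀ * ‖S.v6 n x‖ ^ 2 + (-(S.lam n)⁻¹ ^ 4) * r n x)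
        = G n β - G n 0 := by
      refine intervalIntegral.integral_eq_sub_of_hasDerivAt_of_le hb.le ((cG n).mono sl)
        (fun x hx => (dG n x (Or.inl hx)).congr_deriv ?_) (cint hb.le ?_)
      · rw [if_pos hx.2]; ring
      · exact ((continuousOn_const.mul (i6 n)).add (continuousOn_const.mul (Z'.1 n))).mono sl
    have J2 : ∫ x in β..L, (0 * ‖S.v6 n x‖ ^ 2 + (-(S.lam n)⁻¹ ^ 4) * r n x)
        = G n L - G n β := by
      refine intervalIntegral.integral_eq_sub_of_hasDerivAt_of_le hbL.le ((cG n).mono sr)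
        (fun x hx => (dG n x (Or.inr hx)).congr_deriv ?_) (cint hbL.le ?_)
      · rw [if_neg (not_lt.2 hx.1.le)]; ring
      · exact ((continuousOn_const.mul (i6 n)).add (continuousOn_const.mul (Z'.1 n))).mono sr
    rw [int_lin hb.le ((i6 n).mono sl) ((Z'.1 n).mono sl)] at J1
    rw [int_lin hbL.le ((i6 n).mono sr) ((Z'.1 n).mono sr)] at J2
    have G0 : G n 0 = 0 := by
      obtain ⟨-, h2, -, h4, -, h6, -⟩ := S.bc_zero n
      simp [hG, h2, h4, h6]
    have GLz : G n L = 0 := by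
      obtain ⟨-, h2, -, h4, -, h6, -⟩ := S.bc_L n
      simp [hG, h2, h4, h6]
    have split := intervalIntegral.integral_add_adjacent_intervals
      (cint hb.le ((Z'.1 n).mono sl)) (cint hbL.le ((Z'.1 n).mono sr))
    rw [G0] at J1
    rw [GLz] at J2
    rw [← split]
    have hne := S.lam_ne n
    have hml : S.lam n ^ 4 * (S.lam n)⁻¹ ^ 4 = 1 := by
      rw [← mul_pow, mul_inv_cancel₀ hne, one_pow]
    rw [eq_inv_mul_iff_mul_eq₀ ha.ne']
    linear_combination (S.lam n ^ 4) * (J1 + J2)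
      + ((∫ x in (0 : ℝ)..β, r n x) + ∫ x in β..L, r n x) * hml
  refine ⟨fun n => (continuousOn_const (c := S.lam n ^ 2)).smul ((b6.1 n).mono sl), ?_⟩
  have T := (Z'.tendsto hL.le).const_mul a₀⁻¹
  rw [mul_zero] at T
  refine T.congr fun n => ?_
  rw [← main n, ← intervalIntegral.integral_const_mul]
  refine intervalIntegral.integral_congr fun x _ => ?_
  simp only [norm_smul, Real.norm_eq_abs, mul_pow, sq_abs]
  ring

lemma S2.clm {c d : ℝ} (h : c ≤ d) {f : ℕ → ℝ → ℂ} (hf : S2 c d f) (π : ℂ →L[ℝ] ℝ)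
    (hπ : ∀ z, |π z| ≤ ‖z‖) : S2 c d (fun n x => π (f n x)) :=
  hf.of_le h (fun n => π.continuous.comp_continuousOn (hf.1 n)) 1 fun n x _ => by
    rw [one_mul]; exact hπ _

lemma B2.clm {c d : ℝ} (h : c ≤ d) {f : ℕ → ℝ → ℂ} (hf : B2 c d f) (π : ℂ →L[ℝ] ℝ)
    (hπ : ∀ z, |π z| ≤ ‖z‖) : B2 c d (fun n x => π (f n x)) :=
  hf.of_le h (fun n => π.continuous.comp_continuousOn (hf.1 n)) 1 fun n x _ => by
    rw [one_mul]; exact hπ _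

lemma S2.mulI {c d : ℝ} (h : c ≤ d) {f : ℕ → ℝ → ℂ} (hf : S2 c d f) :
    S2 c d (fun n x => Complex.I * f n x) :=
  hf.of_le h (fun n => continuousOn_const.mul (hf.1 n)) 1 fun n x _ => by simp

lemma inv_pow_tendsto {lam : ℕ → ℝ} (mu : Tendsto (fun n => (lam n)⁻¹) atTop (nhds 0))
    (j : ℕ) (hj : j ≠ 0) : Tendsto (fun n => (lam n)⁻¹ ^ j) atTop (nhds 0) := by
  simpa [hj] using mu.pow j

/-- a displacement multiplied by the frequency is bounded -/
lemma bdd_lam {c d : ℝ} (h : c ≤ d) {lam : ℕ → ℝ}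
    (mu : Tendsto (fun n => (lam n)⁻¹) atTop (nhds 0)) {v w f : ℕ → ℝ → ℂ}
    (hv : ∀ n, ContinuousOn (v n) (Icc c d)) (hw : B2 c d w) (hf : S2 c d f)
    (he : ∀ n, ∀ x ∈ Ioo c d,
      w n x = Complex.I * lam n * v n x - (((lam n)⁻¹ ^ 4 : ℝ) : ℂ) * f n x) :
    B2 c d (fun n x => lam n • v n x) := by
  have h1 := hw.add h (hf.toB2.scale h (inv_pow_tendsto mu 4 (by norm_num))).toB2
  have cv : ∀ n, ContinuousOn (fun x => lam n • v n x) (Icc c d) :=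
    fun n => (continuousOn_const (c := lam n)).smul (hv n)
  have h2 : B2 c d (fun n x => Complex.I * (lam n • v n x)) :=
    h1.congr h (fun n => continuousOn_const.mul (cv n)) fun n x hx => by
      rw [he n x hx, Complex.real_smul, Complex.real_smul]
      ring
  exact h2.of_le h cv 1 fun n x _ => by simp

lemma bdd_unlam {c d : ℝ} (h : c ≤ d) {lam : ℕ → ℝ} (hne : ∀ n, lam n ≠ 0)
    (mu : Tendsto (fun n => (lam n)⁻¹) atTop (nhds 0)) {v : ℕ → ℝ → ℂ}
    (hv : ∀ n, ContinuousOn (v n) (Icc c d))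
    (hb : B2 c d (fun n x => lam n • v n x)) : B2 c d v :=
  (hb.scale h mu).toB2.congr h hv fun n x _ => inv_smul_smul₀ (hne n) _

/-- passing to a real second order system on an interval -/
lemma mkRed (hr1 : 0 < ρ₁) (hr2 : 0 < ρ₂) (hk1 : 0 < k₁) (hk2 : 0 < k₂) (hk3 : 0 < k₃)
    (hb : 0 < β) (hbL : β < L) (S : BresseSetting ρ₁ ρ₂ k₁ k₂ k₃ l L β a₀ 4)
    (π : ℂ →L[ℝ] ℝ) (hπ : ∀ z, |π z| ≤ ‖z‖) {c d a : ℝ} (hcd : c ≤ d) (h0 : 0 ≤ c) (hdL : d ≤ L)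
    (hsub : Ioo c d ⊆ Ioo (0 : ℝ) β ∪ Ioo β L)
    (ha : ∀ x ∈ Ioo c d, (if x < β then a₀ else 0) = a)
    (hs : S2 c d (fun n x => a • (S.lam n • S.v6 n x))) :
    Red ρ₁ ρ₂ k₁ k₂ k₃ l c d S.lam (fun n x => π (S.v1 n x)) (fun n x => π (S.v3 n x))
      (fun n x => π (S.v5 n x)) (fun n x => π (DW L S.v1 n x)) (fun n x => π (DW L S.v3 n x))
      (fun n x => π (DW L S.v5 n x))
      (fun n x => π ((-ρ₁) • (Complex.I * ((S.lam n)⁻¹ ^ 3 • S.f1 n x)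
        + (S.lam n)⁻¹ ^ 4 • S.f2 n x)))
      (fun n x => π ((-ρ₂) • (Complex.I * ((S.lam n)⁻¹ ^ 3 • S.f3 n x)
        + (S.lam n)⁻¹ ^ 4 • S.f4 n x)))
      (fun n x => π (a • S.v6 n x + (-ρ₁) • (Complex.I * ((S.lam n)⁻¹ ^ 3 • S.f5 n x)
        + (S.lam n)⁻¹ ^ 4 • S.f6 n x))) := by
  have hL : 0 < L := hb.trans hbL
  have mu := inv_lam_tendsto S.lam_tendsto
  have hss : Icc c d ⊆ Icc 0 L := Icc_subset_Icc h0 hdL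
  obtain ⟨s2, s4, s6, sP, s3', sQ, s1, s3, s5⟩ := small_F hr1 hr2 hk1 hk2 hk3 hL S
  obtain ⟨b2, b4, b6, bP, b3', bQ⟩ := bdd_U hr1 hr2 hk1 hk2 hk3 hL S
  replace s1 := s1.mono h0 hcd hdL
  replace s2 := s2.mono h0 hcd hdL
  replace s3 := s3.mono h0 hcd hdL
  replace s4 := s4.mono h0 hcd hdL
  replace s5 := s5.mono h0 hcd hdL
  replace s6 := s6.mono h0 hcd hdL
  replace b2 := b2.mono h0 hcd hdL
  replace b4 := b4.mono h0 hcd hdL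
  replace b6 := b6.mono h0 hcd hdL
  replace bP := bP.mono h0 hcd hdL
  replace b3' := b3'.mono h0 hcd hdL
  replace bQ := bQ.mono h0 hcd hdL
  have c1 := fun n => (S.reg_v1 n).continuousOn.mono hss
  have c3 := fun n => (S.reg_v3 n).continuousOn.mono hss
  have c5 := fun n => (S.reg_v5 n).continuousOn.mono hss
  have q1 : ∀ n, ContDiffOn ℝ 1 (S.v1 n) (Icc 0 L) := fun n => (S.reg_v1 n).of_le one_le_two
  have q3 : ∀ n, ContDiffOn ℝ 1 (S.v3 n) (Icc 0 L) := fun n => (S.reg_v3 n).of_le one_le_two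
  have e1 : ∀ n, ContinuousOn (DW L S.v1 n) (Icc c d) := fun n => (cD hL (q1 n)).mono hss
  have e5 : ∀ n, ContinuousOn (DW L S.v5 n) (Icc c d) := fun n => (cD hL (S.reg_v5 n)).mono hss
  have y1 := bdd_lam hcd mu c1 b2 s1 fun n x hx => (first_eqs S n (hsub hx)).1
  have y3 := bdd_lam hcd mu c3 b4 s3 fun n x hx => (first_eqs S n (hsub hx)).2.1
  have y5 := bdd_lam hcd mu c5 b6 s5 fun n x hx => (first_eqs S n (hsub hx)).2.2
  have u1 := bdd_unlam hcd S.lam_ne mu c1 y1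
  have u3 := bdd_unlam hcd S.lam_ne mu c3 y3
  have u5 := bdd_unlam hcd S.lam_ne mu c5 y5
  have bp1 : B2 c d (DW L S.v1) :=
    (bP.add hcd ((u3.smul hcd (-1)).add hcd (u5.smul hcd (-l)))).congr hcd e1 fun n x _ => by
      simp only [Complex.real_smul]
      push_cast
      ring
  have bp5 : B2 c d (DW L S.v5) :=
    (bQ.add hcd (u1.smul hcd l)).congr hcd e5 fun n x _ => by
      simp only [Complex.real_smul]
      ring
  have sg : ∀ {f g : ℕ → ℝ → ℂ} (i j : ℕ) (r : ℝ), S2 c d f → S2 c d g →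
      S2 c d (fun n x => (-r) • (Complex.I * ((S.lam n)⁻¹ ^ (i + 1) • f n x)
        + (S.lam n)⁻¹ ^ (j + 1) • g n x)) := fun i j r hf hg =>
    S2.smul hcd (((hf.toB2.scale hcd (inv_pow_tendsto mu (i + 1) (by omega))).mulI hcd).add hcd
      (hg.toB2.scale hcd (inv_pow_tendsto mu (j + 1) (by omega)))) (-r)
  have dπ : ∀ {f : ℝ → ℂ} {z : ℂ} {x : ℝ}, HasDerivAt f z x →
      HasDerivAt (fun x => π (f x)) (π z) x := fun h => π.hasFDerivAt.comp_hasDerivAt _ h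
  have sg3 := sg 2 3 ρ₁ s5 s6
  have hxL : ∀ x ∈ Ioo c d, x ∈ Ioo 0 L := fun x hx => pieces_sub hb hbL (hsub hx)
  have lamc : ∀ n, (S.lam n : ℂ) ≠ 0 := fun n => Complex.ofReal_ne_zero.2 (S.lam_ne n)
  have hml : ∀ n, (S.lam n : ℂ) * (S.lam n : ℂ)⁻¹ ^ 4 = (S.lam n : ℂ)⁻¹ ^ 3 := fun n => by
    have := lamc n
    field_simp
  have hI := Complex.I_sq
  exact
    { hcd := hcd
      lam_ne := S.lam_ne
      mu := mu
      cv1 := fun n => π.continuous.comp_continuousOn (c1 n)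
      cv3 := fun n => π.continuous.comp_continuousOn (c3 n)
      cv5 := fun n => π.continuous.comp_continuousOn (c5 n)
      by1 := by simpa only [map_smul, smul_eq_mul] using y1.clm hcd π hπ
      by3 := by simpa only [map_smul, smul_eq_mul] using y3.clm hcd π hπ
      by5 := by simpa only [map_smul, smul_eq_mul] using y5.clm hcd π hπ
      bp1 := bp1.clm hcd π hπ
      bp3 := b3'.clm hcd π hπ
      bp5 := bp5.clm hcd π hπ
      sg1 := (sg 2 3 ρ₁ s1 s2).clm hcd π hπ
      sg2 := (sg 2 3 ρ₂ s3 s4).clm hcd π hπ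
      cg3 := fun n => π.continuous.comp_continuousOn
        (((continuousOn_const (c := a)).smul (b6.1 n)).add (sg3.1 n))
      slg3 := by
        have h1 := hs.add hcd (sg 1 2 ρ₁ s5 s6)
        have h2 : S2 c d (fun n x => S.lam n • (a • S.v6 n x +
            (-ρ₁) • (Complex.I * ((S.lam n)⁻¹ ^ 3 • S.f5 n x)
            + (S.lam n)⁻¹ ^ 4 • S.f6 n x))) := by
          refine h1.congr hcd (fun n => (continuousOn_const (c := S.lam n)).smul
            (((continuousOn_const (c := a)).smul (b6.1 n)).add (sg3.1 n))) fun n x _ => ?_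
          have := lamc n
          simp only [Complex.real_smul]
          push_cast
          field_simp
        simpa only [map_smul, smul_eq_mul] using h2.clm hcd π hπ
      dv1 := fun n x hx => dπ (hD (q1 n) (hxL x hx))
      dv3 := fun n x hx => dπ (hD (q3 n) (hxL x hx))
      dv5 := fun n x hx => dπ (hD (S.reg_v5 n) (hxL x hx))
      dp1 := fun n x hx => by
        obtain ⟨w1, w3, w5, D1, D3, D5, E1, E3, E5⟩ := eqs hb hbL S n (hsub hx)
        obtain ⟨Q1, Q3, Q5⟩ := first_eqs S n (hsub hx)
        refine (dπ D1).congr_deriv ?_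
        have H : k₁ • w1 = (-ρ₁ * S.lam n ^ 2) • S.v1 n x - k₁ • DW L S.v3 n x
            - (l * (k₁ + k₃)) • DW L S.v5 n x + (l ^ 2 * k₃) • S.v1 n x
            + (-ρ₁) • (Complex.I * ((S.lam n)⁻¹ ^ 3 • S.f1 n x)
              + (S.lam n)⁻¹ ^ 4 • S.f2 n x) := by
          simp only [Complex.real_smul]
          push_cast at *
          linear_combination E1 + Complex.I * S.lam n * ρ₁ * Q1
            + ρ₁ * S.lam n ^ 2 * S.v1 n x * hI - Complex.I * ρ₁ * S.f1 n x * hml n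
        have H' := congrArg π H
        rw [map_add, map_add, map_sub, map_sub, map_smul, map_smul, map_smul, map_smul,
          map_smul] at H'
        rw [eq_div_iff hk1.ne']
        simp only [smul_eq_mul] at H'
        linear_combination H'
      dp3 := fun n x hx => by
        obtain ⟨w1, w3, w5, D1, D3, D5, E1, E3, E5⟩ := eqs hb hbL S n (hsub hx)
        obtain ⟨Q1, Q3, Q5⟩ := first_eqs S n (hsub hx)
        refine (dπ D3).congr_deriv ?_
        have H : k₂ • w3 = (-ρ₂ * S.lam n ^ 2) • S.v3 n x
            + k₁ • (DW L S.v1 n x + S.v3 n x + l • S.v5 n x)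
            + (-ρ₂) • (Complex.I * ((S.lam n)⁻¹ ^ 3 • S.f3 n x)
              + (S.lam n)⁻¹ ^ 4 • S.f4 n x) := by
          simp only [Complex.real_smul]
          push_cast at *
          linear_combination E3 + Complex.I * S.lam n * ρ₂ * Q3
            + ρ₂ * S.lam n ^ 2 * S.v3 n x * hI - Complex.I * ρ₂ * S.f3 n x * hml n
        have H' := congrArg π H
        rw [map_add, map_add, map_smul, map_smul, map_smul, map_add, map_add, map_smul] at H'
        rw [eq_div_iff hk2.ne']
        simp only [smul_eq_mul] at H'
        linear_combination H'
      dp5 := fun n x hx => by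
        obtain ⟨w1, w3, w5, D1, D3, D5, E1, E3, E5⟩ := eqs hb hbL S n (hsub hx)
        obtain ⟨Q1, Q3, Q5⟩ := first_eqs S n (hsub hx)
        rw [ha x hx] at E5
        refine (dπ D5).congr_deriv ?_
        have H : k₃ • w5 = (-ρ₁ * S.lam n ^ 2) • S.v5 n x + (l * (k₁ + k₃)) • DW L S.v1 n x
            + (l * k₁) • (S.v3 n x + l • S.v5 n x)
            + (a • S.v6 n x + (-ρ₁) • (Complex.I * ((S.lam n)⁻¹ ^ 3 • S.f5 n x)
              + (S.lam n)⁻¹ ^ 4 • S.f6 n x)) := by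
          simp only [Complex.real_smul]
          push_cast at *
          linear_combination E5 + Complex.I * S.lam n * ρ₁ * Q5
            + ρ₁ * S.lam n ^ 2 * S.v5 n x * hI - Complex.I * ρ₁ * S.f5 n x * hml n
        have H' := congrArg π H
        rw [map_add, map_add, map_add, map_smul, map_smul, map_smul, map_smul, map_add,
          map_smul] at H'
        rw [eq_div_iff hk3.ne']
        simp only [smul_eq_mul] at H'
        linear_combination H' }

lemma small_v5 (hr1 : 0 < ρ₁) (hr2 : 0 < ρ₂) (hk1 : 0 < k₁) (hk2 : 0 < k₂) (hk3 : 0 < k₃)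
    (ha : 0 < a₀) (hb : 0 < β) (hbL : β < L) (S : BresseSetting ρ₁ ρ₂ k₁ k₂ k₃ l L β a₀ 4) :
    S2 0 β (fun n x => S.lam n ^ 3 • S.v5 n x) := by
  have hL : 0 < L := hb.trans hbL
  have mu := inv_lam_tendsto S.lam_tendsto
  have s6 := small_v6 hr1 hr2 hk1 hk2 hk3 ha hb hbL S
  obtain ⟨-, -, -, -, -, -, -, -, s5⟩ := small_F hr1 hr2 hk1 hk2 hk3 hL S
  replace s5 := s5.mono le_rfl hb.le hbL.le
  have cv : ∀ n, ContinuousOn (fun x => S.lam n ^ 3 • S.v5 n x) (Icc 0 β) := fun n =>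
    (continuousOn_const (c := S.lam n ^ 3)).smul
      ((S.reg_v5 n).continuousOn.mono (Icc_subset_Icc le_rfl hbL.le))
  have h1 := s6.add hb.le (s5.toB2.scale hb.le (inv_pow_tendsto mu 2 (by norm_num)))
  have h2 : S2 0 β (fun n x => Complex.I * (S.lam n ^ 3 • S.v5 n x)) :=
    h1.congr hb.le (fun n => continuousOn_const.mul (cv n)) fun n x hx => by
      rw [(first_eqs S n (Or.inl hx)).2.2]
      have : (S.lam n : ℂ) ≠ 0 := Complex.ofReal_ne_zero.2 (S.lam_ne n)
      simp only [Complex.real_smul]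
      push_cast
      field_simp
      ring
  exact h2.of_le hb.le cv 1 fun n x _ => by simp

/-- the full energy density tends to zero uniformly -/
lemma energy_small (hr1 : 0 < ρ₁) (hr2 : 0 < ρ₂) (hk1 : 0 < k₁) (hk2 : 0 < k₂) (hk3 : 0 < k₃)
    (hl : 0 < l) (ha : 0 < a₀) (hb : 0 < β) (hbL : β < L)
    (S : BresseSetting ρ₁ ρ₂ k₁ k₂ k₃ l L β a₀ 4) :
    ∃ δ : ℕ → ℝ, Tendsto δ atTop (nhds 0) ∧ ∀ n, ∀ x ∈ Icc 0 L,
      ρ₁ * S.lam n ^ 2 * ‖S.v1 n x‖ ^ 2 + k₁ * ‖DW L S.v1 n x‖ ^ 2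
        + ρ₂ * S.lam n ^ 2 * ‖S.v3 n x‖ ^ 2 + k₂ * ‖DW L S.v3 n x‖ ^ 2
        + k₃ * ‖DW L S.v5 n x‖ ^ 2 + ρ₁ * S.lam n ^ 2 * ‖S.v5 n x‖ ^ 2 ≤ δ n := by
  have hL : 0 < L := hb.trans hbL
  have mu := inv_lam_tendsto S.lam_tendsto
  have s6 := small_v6 hr1 hr2 hk1 hk2 hk3 ha hb hbL S
  have s5 := small_v5 hr1 hr2 hk1 hk2 hk3 ha hb hbL S
  have sl : S2 0 β (fun n x => a₀ • (S.lam n • S.v6 n x)) := by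
    refine ((s6.toB2.scale hb.le mu).smul hb.le a₀).congr hb.le (fun n => ?_) fun n x _ => ?_
    · exact (continuousOn_const (c := a₀)).smul ((continuousOn_const (c := S.lam n)).smul
        ((S.reg_v6 n).continuousOn.mono (Icc_subset_Icc le_rfl hbL.le)))
    · have := S.lam_ne n
      rw [smul_smul (S.lam n)⁻¹]
      congr 2
      field_simp
  have sr : S2 β L (fun n x => (0 : ℝ) • (S.lam n • S.v6 n x)) := by
    refine ⟨fun n => ?_, ?_⟩
    · simpa using continuousOn_const
    · simp
  have key : ∀ (π : ℂ →L[ℝ] ℝ), (∀ z, |π z| ≤ ‖z‖) → ∃ δ : ℕ → ℝ, Tendsto δ atTop (nhds 0) ∧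
      ∀ n, ∀ x ∈ Icc 0 L, Red.EN ρ₁ ρ₂ k₁ k₂ k₃ S.lam (fun n x => π (S.v1 n x))
        (fun n x => π (S.v3 n x)) (fun n x => π (S.v5 n x)) (fun n x => π (DW L S.v1 n x))
        (fun n x => π (DW L S.v3 n x)) (fun n x => π (DW L S.v5 n x)) n x ≤ δ n := by
    intro π hπ
    have R := mkRed hr1 hr2 hk1 hk2 hk3 hb hbL S π hπ hb.le le_rfl hbL.le
      (subset_union_left) (fun x hx => if_pos hx.2) sl
    have R' := mkRed hr1 hr2 hk1 hk2 hk3 hb hbL S π hπ hbL.le hb.le le_rfl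
      (subset_union_right) (fun x hx => if_neg (not_lt.2 hx.1.le)) sr
    refine R.global R' hb hr1 hr2 hk1 hk2 hk3 hl ?_
    simpa only [map_smul, smul_eq_mul] using s5.clm hb.le π hπ
  obtain ⟨δ, hδ, h1⟩ := key Complex.reCLM fun z => Complex.abs_re_le_norm z
  obtain ⟨η, hη, h2⟩ := key Complex.imCLM fun z => Complex.abs_im_le_norm z
  refine ⟨fun n => δ n + η n, by simpa using hδ.add hη, fun n x hx => ?_⟩
  have a1 := h1 n x hx
  have a2 := h2 n x hx
  simp only [Red.EN, Complex.reCLM_apply, Complex.imCLM_apply] at a1 a2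
  simp only [nsq_eq]
  linarith

end Setting

theorem bresse_lemma7_H3 (ρ₁ ρ₂ k₁ k₂ k₃ l L β a₀ : ℝ) (ℓ : ℕ)
    (hrho1 : 0 < ρ₁) (hrho2 : 0 < ρ₂) (hk1 : 0 < k₁) (hk2 : 0 < k₂) (hk3 : 0 < k₃)
    (hl : 0 < l) (hL : 0 < L) (ha0 : 0 < a₀) (hbeta : 0 < β) (hbetaL : β < L)
    (S : BresseSetting ρ₁ ρ₂ k₁ k₂ k₃ l L β a₀ ℓ)
    (hH : k₁ / ρ₁ ≠ k₂ / ρ₂ ∧ ℓ = 4) :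
    ∀ ε : ℝ, 0 < ε → ε < β / 12 →
    Tendsto (fun n =>
      (∫ x in (0 : ℝ)..(6 * ε),
        (ρ₁ * (S.lam n) ^ 2 * ‖S.v1 n x‖ ^ 2 + k₁ * ‖deriv (S.v1 n) x‖ ^ 2
          + ρ₂ * (S.lam n) ^ 2 * ‖S.v3 n x‖ ^ 2 + k₂ * ‖deriv (S.v3 n) x‖ ^ 2
          + k₃ * ‖deriv (S.v5 n) x‖ ^ 2))
      + (∫ x in (β - 6 * ε)..L,
        (ρ₁ * (S.lam n) ^ 2 * ‖S.v1 n x‖ ^ 2 + k₁ * ‖deriv (S.v1 n) x‖ ^ 2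
          + ρ₂ * (S.lam n) ^ 2 * ‖S.v3 n x‖ ^ 2 + k₂ * ‖deriv (S.v3 n) x‖ ^ 2
          + k₃ * ‖deriv (S.v5 n) x‖ ^ 2))
      + ρ₁ * (S.lam n) ^ 2 * ∫ x in β..L, ‖S.v5 n x‖ ^ 2) atTop (nhds 0) := by
  obtain ⟨-, rfl⟩ := hH
  intro ε hε hεβ
  obtain ⟨δ, hδ, hE⟩ := energy_small hrho1 hrho2 hk1 hk2 hk3 hl ha0 hbeta hbetaL S
  have q1 : ∀ n, ContDiffOn ℝ 1 (S.v1 n) (Icc 0 L) := fun n => (S.reg_v1 n).of_le one_le_two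
  have q3 : ∀ n, ContDiffOn ℝ 1 (S.v3 n) (Icc 0 L) := fun n => (S.reg_v3 n).of_le one_le_two
  have hδ0 : ∀ n, 0 ≤ δ n := fun n => le_trans (by positivity) (hE n 0 ⟨le_rfl, hL.le⟩)
  have hI : ∀ n c d, 0 ≤ c → c ≤ d → d ≤ L →
      0 ≤ (∫ x in c..d, (ρ₁ * (S.lam n) ^ 2 * ‖S.v1 n x‖ ^ 2 + k₁ * ‖deriv (S.v1 n) x‖ ^ 2
          + ρ₂ * (S.lam n) ^ 2 * ‖S.v3 n x‖ ^ 2 + k₂ * ‖deriv (S.v3 n) x‖ ^ 2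
          + k₃ * ‖deriv (S.v5 n) x‖ ^ 2)) ∧
      (∫ x in c..d, (ρ₁ * (S.lam n) ^ 2 * ‖S.v1 n x‖ ^ 2 + k₁ * ‖deriv (S.v1 n) x‖ ^ 2
          + ρ₂ * (S.lam n) ^ 2 * ‖S.v3 n x‖ ^ 2 + k₂ * ‖deriv (S.v3 n) x‖ ^ 2
          + k₃ * ‖deriv (S.v5 n) x‖ ^ 2)) ≤ L * δ n := by
    intro n c d hc hcd hd
    refine ⟨int_nonneg hcd fun x _ => by positivity, ?_⟩
    have hss : Icc c d ⊆ Icc 0 L := Icc_subset_Icc hc hd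
    have h1 := (S.reg_v1 n).continuousOn.mono hss
    have h3 := (S.reg_v3 n).continuousOn.mono hss
    have e1 : ContinuousOn (DW L S.v1 n) (Icc c d) := (cD hL (q1 n)).mono hss
    have e3 : ContinuousOn (DW L S.v3 n) (Icc c d) := (cD hL (q3 n)).mono hss
    have e5 : ContinuousOn (DW L S.v5 n) (Icc c d) := (cD hL (S.reg_v5 n)).mono hss
    have eq : (∫ x in c..d, (ρ₁ * (S.lam n) ^ 2 * ‖S.v1 n x‖ ^ 2 + k₁ * ‖deriv (S.v1 n) x‖ ^ 2
          + ρ₂ * (S.lam n) ^ 2 * ‖S.v3 n x‖ ^ 2 + k₂ * ‖deriv (S.v3 n) x‖ ^ 2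
          + k₃ * ‖deriv (S.v5 n) x‖ ^ 2))
        = ∫ x in c..d, (ρ₁ * (S.lam n) ^ 2 * ‖S.v1 n x‖ ^ 2 + k₁ * ‖DW L S.v1 n x‖ ^ 2
          + ρ₂ * (S.lam n) ^ 2 * ‖S.v3 n x‖ ^ 2 + k₂ * ‖DW L S.v3 n x‖ ^ 2
          + k₃ * ‖DW L S.v5 n x‖ ^ 2) := by
      refine intervalIntegral.integral_congr_Ioo_of_le hcd fun x hx => ?_
      have hx' : x ∈ Ioo 0 L := ⟨hc.trans_lt hx.1, hx.2.trans_le hd⟩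
      simp only [DW]
      rw [hD_eq (q1 n) hx', hD_eq (q3 n) hx', hD_eq (S.reg_v5 n) hx']
    rw [eq]
    have := int_mono hcd (f := fun x => ρ₁ * (S.lam n) ^ 2 * ‖S.v1 n x‖ ^ 2
          + k₁ * ‖DW L S.v1 n x‖ ^ 2
          + ρ₂ * (S.lam n) ^ 2 * ‖S.v3 n x‖ ^ 2 + k₂ * ‖DW L S.v3 n x‖ ^ 2
          + k₃ * ‖DW L S.v5 n x‖ ^ 2) (g := fun _ => δ n) (by fun_prop) continuousOn_const
      fun x hx => by
        have h5 : 0 ≤ ρ₁ * S.lam n ^ 2 * ‖S.v5 n x‖ ^ 2 := by positivity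
        linarith [hE n x (hss hx)]
    rw [intervalIntegral.integral_const, smul_eq_mul] at this
    exact this.trans (mul_le_mul_of_nonneg_right (by linarith) (hδ0 n))
  have hV : ∀ n, ρ₁ * (S.lam n) ^ 2 * (∫ x in β..L, ‖S.v5 n x‖ ^ 2) ≤ L * δ n := by
    intro n
    rw [← intervalIntegral.integral_const_mul]
    have hss : Icc β L ⊆ Icc 0 L := Icc_subset_Icc hbeta.le le_rfl
    have h5 := (S.reg_v5 n).continuousOn.mono hss
    have := int_mono hbetaL.le (f := fun x => ρ₁ * (S.lam n) ^ 2 * ‖S.v5 n x‖ ^ 2)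
      (g := fun _ => δ n) (by fun_prop) continuousOn_const
      fun x hx => by
        have := hE n x (hss hx)
        have h6 : 0 ≤ ρ₁ * (S.lam n) ^ 2 * ‖S.v1 n x‖ ^ 2 + k₁ * ‖DW L S.v1 n x‖ ^ 2
          + ρ₂ * (S.lam n) ^ 2 * ‖S.v3 n x‖ ^ 2 + k₂ * ‖DW L S.v3 n x‖ ^ 2
          + k₃ * ‖DW L S.v5 n x‖ ^ 2 := by positivity
        linarith
    rw [intervalIntegral.integral_const, smul_eq_mul] at this
    exact this.trans (mul_le_mul_of_nonneg_right (by linarith) (hδ0 n))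
  refine squeeze_zero (g := fun n => 3 * (L * δ n)) (fun n => ?_) (fun n => ?_) ?_
  · have h1 := (hI n 0 (6 * ε) le_rfl (by linarith) (by linarith)).1
    have h2 := (hI n (β - 6 * ε) L (by linarith) (by linarith) le_rfl).1
    have h3 : 0 ≤ ∫ x in β..L, ‖S.v5 n x‖ ^ 2 := int_nonneg hbetaL.le fun x _ => by positivity
    positivity
  · have h1 := (hI n 0 (6 * ε) le_rfl (by linarith) (by linarith)).2
    have h2 := (hI n (β - 6 * ε) L (by linarith) (by linarith) le_rfl).2
    linarith [hV n]
  · simpa using (hδ.const_mul L).const_mul 3
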